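/- Assume the standing conditions on H, f, m₀, u_T and that α < γ'/N. Then c := inf_{(m,w) ∈ K} E(m,w) is finite. Moreover, for every e ∈ ℝ there exists c₁ > 0 (depending on e, T, N, α, γ, the structural constants and the data) such that every (m,w) ∈ K with E(m,w) ≤ e satisfies ∫_Q m^{α+1} dx dt + ∫_Q |w|^{γ'} m^{1−γ'} dx dt ≤ c₁. -/

import Mathlib

open MeasureTheory Set Filter Topology

noncomputable section

/-- Points of `ℝ^N`.  `ℤ^N`-periodic functions on `RN N` model functions on the
flat torus `T^N`. -/
abbrev RN (N : ℕ) := Fin N → ℝ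

/-- The Euclidean norm on `ℝ^N`. -/
def euclNorm {N : ℕ} (p : RN N) : ℝ := Real.sqrt (∑ i, p i ^ 2)

/-- The Euclidean inner product on `ℝ^N`. -/
def dotp {N : ℕ} (p q : RN N) : ℝ := ∑ i, p i * q i

/-- `ℤ^N`-periodicity: such functions are exactly the functions on the flat torus `T^N`. -/
def ZPeriodic {N : ℕ} {β : Type*} (u : RN N → β) : Prop :=
  ∀ (x : RN N) (z : Fin N → ℤ), u (fun i => x i + (z i : ℝ)) = u x

/-- Partial derivative in the `i`-th coordinate direction. -/
def pd {N : ℕ} (i : Fin N) (u : RN N → ℝ) (x : RN N) : ℝ := fderiv ℝ u x (Pi.single i 1)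

/-- Spatial gradient. -/
def grad {N : ℕ} (u : RN N → ℝ) (x : RN N) : RN N := fun i => pd i u x

/-- Divergence of a vector field. -/
def dive {N : ℕ} (w : RN N → RN N) (x : RN N) : ℝ := ∑ i, pd i (fun y => w y i) x

/-- Laplacian. -/
def lap {N : ℕ} (u : RN N → ℝ) (x : RN N) : ℝ := ∑ i, pd i (pd i u) x

/-- The unit cube, a fundamental domain for the torus `T^N` (of total measure `1`,
so that the measure on the torus is the normalized one). -/
def cube (N : ℕ) : Set (RN N) := Set.Icc 0 1

/-- The space-time cylinder `Q = T^N × (0,T)`. -/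
def QQ (N : ℕ) (T : ℝ) : Set (RN N × ℝ) := cube N ×ˢ Ioo 0 T

/-- Integral over `Q = T^N × (0,T)`. -/
def intQ (N : ℕ) (T : ℝ) (f : RN N → ℝ → ℝ) : ℝ := ∫ q in QQ N T, f q.1 q.2

/-- Smooth space-periodic test functions on `T^N × [0,T]`. -/
def IsTest (N : ℕ) (φ : RN N → ℝ → ℝ) : Prop :=
  ContDiff ℝ (⊤ : ℕ∞) (fun q : RN N × ℝ => φ q.1 q.2) ∧ ∀ t, ZPeriodic fun x => φ x t

/-- The Legendre transform `L(q) = sup_p (p·q - H(p))`. -/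
def Leg {N : ℕ} (H : RN N → ℝ) (q : RN N) : ℝ := sSup ((fun p => dotp p q - H p) '' Set.univ)

/-- `m L(-w/m)`, with the convention that it vanishes when `m ≤ 0` (recall that in `K`
one has `w = 0` a.e. on `{m = 0}`). -/
def mLag {N : ℕ} (L : RN N → ℝ) (mv : ℝ) (wv : RN N) : ℝ :=
  if 0 < mv then mv * L ((-mv⁻¹) • wv) else 0

/-- `|w|^{γ'} m^{1-γ'}`, with the convention that it vanishes when `m ≤ 0`. -/
def kinQ {N : ℕ} (γ' : ℝ) (mv : ℝ) (wv : RN N) : ℝ :=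
  if 0 < mv then euclNorm wv ^ γ' * mv ^ (1 - γ') else 0

/-- `F(x,m) = ∫_0^m f(x,σ) dσ`. -/
def Fint {N : ℕ} (f : RN N → ℝ → ℝ) (x : RN N) (mv : ℝ) : ℝ := ∫ σ in (0:ℝ)..mv, f x σ

/-- The convexifying term `G(x,t,m)`, as a function of `m̄(x,t)` (argument `mb`) and `m`. -/
def Gcvx (c_f α mb mv : ℝ) : ℝ :=
  ((c_f + 1) / (α * (α + 1))) * ((mv + 1) ^ (α + 1) - (mb + 1) ^ (α + 1))
    - ((c_f + 1) / α) * (mb + 1) ^ α * (mv - mb)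

/-- `g = ∂_m G`, as a function of `m̄(x,t)` (argument `mb`) and `m`. -/
def gcvx (c_f α mb mv : ℝ) : ℝ := ((c_f + 1) / α) * ((mv + 1) ^ α - (mb + 1) ^ α)

/-- The penalised Lagrangian `L_η(q) = L(q) + (η/(N+3)) |q|^{N+3}`. -/
def Lpen {N : ℕ} (L : RN N → ℝ) (η : ℝ) (q : RN N) : ℝ :=
  L q + (η / ((N : ℝ) + 3)) * euclNorm q ^ ((N : ℝ) + 3)

/-- The penalised Hamiltonian `H_η`, the Legendre transform of `L_η`. -/
def Hpen {N : ℕ} (L : RN N → ℝ) (η : ℝ) : RN N → ℝ := Leg (Lpen L η)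

/-- `g` is the weak spatial gradient of `m` on `Q`. -/
def HasWeakGradQ (N : ℕ) (T : ℝ) (m : RN N → ℝ → ℝ) (g : RN N → ℝ → RN N) : Prop :=
  ∀ Φ : RN N → ℝ → RN N, ContDiff ℝ (⊤ : ℕ∞) (fun q : RN N × ℝ => Φ q.1 q.2) →
    (∀ t, ZPeriodic fun x => Φ x t) →
    intQ N T (fun x t => m x t * dive (fun y => Φ y t) x)
      = -intQ N T (fun x t => dotp (g x t) (Φ x t))

/-- `m` is `θ`-Hölder continuous on `T^N × [0,T]` with constant `C`. -/
def HolderOnQ (N : ℕ) (T C θ : ℝ) (m : RN N → ℝ → ℝ) : Prop :=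
  ∀ x t x' t', t ∈ Icc (0:ℝ) T → t' ∈ Icc (0:ℝ) T →
    |m x t - m x' t'| ≤
      C * Real.sqrt (euclNorm (fun i => x i - x' i) ^ 2 + (t - t') ^ 2) ^ θ

/-- Membership in the constraint set `K`: `(m,w) ∈ L^{α+1}(Q) × L¹(Q;ℝ^N)`, `m ≥ 0`,
`|w|^{γ'} m^{1-γ'} ∈ L¹(Q)`, together with the weak Fokker–Planck constraint
(with initial datum `m₀`); the field `traceId` states that `m(·,T)` is the time-`T`
trace of `m` determined by the constraint. -/
structure MemK (N : ℕ) (T α γ' : ℝ) (m₀ : RN N → ℝ)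
    (m : RN N → ℝ → ℝ) (w : RN N → ℝ → RN N) : Prop where
  per_m : ∀ t, ZPeriodic fun x => m x t
  per_w : ∀ t, ZPeriodic fun x => w x t
  nonneg : ∀ x t, 0 ≤ m x t
  lp_m : IntegrableOn (fun q : RN N × ℝ => m q.1 q.2 ^ (α + 1)) (QQ N T)
  l1_w : IntegrableOn (fun q : RN N × ℝ => w q.1 q.2) (QQ N T)
  vanish : ∀ᵐ q ∂(volume.restrict (QQ N T)), m q.1 q.2 = 0 → w q.1 q.2 = 0
  kin_int : IntegrableOn (fun q : RN N × ℝ => kinQ γ' (m q.1 q.2) (w q.1 q.2)) (QQ N T)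
  traceInt : IntegrableOn (fun x => m x T) (cube N)
  fp : ∀ φ : RN N → ℝ → ℝ, IsTest N φ → (∀ x, φ x T = 0) →
    intQ N T (fun x t => m x t * deriv (φ x) t + dotp (w x t) (grad (fun y => φ y t) x)
        + m x t * lap (fun y => φ y t) x)
      + (∫ x in cube N, m₀ x * φ x 0) = 0
  traceId : ∀ φ : RN N → ℝ → ℝ, IsTest N φ →
    intQ N T (fun x t => m x t * deriv (φ x) t + dotp (w x t) (grad (fun y => φ y t) x)
        + m x t * lap (fun y => φ y t) x)
      + (∫ x in cube N, m₀ x * φ x 0) - (∫ x in cube N, m x T * φ x T) = 0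

/-- The energy functional `E` on `K`, with Lagrangian `L` and coupling antiderivative `F`. -/
def energyF (N : ℕ) (T : ℝ) (L : RN N → ℝ) (F : RN N → ℝ → ℝ) (uT : RN N → ℝ)
    (m : RN N → ℝ → ℝ) (w : RN N → ℝ → RN N) : ℝ :=
  intQ N T (fun x t => mLag L (m x t) (w x t) - F x (m x t)) + ∫ x in cube N, uT x * m x T

/-- `(m,w)` belongs to `K` and minimises the energy over `K`. -/
def MinimisesE (N : ℕ) (T α γ' : ℝ) (m₀ : RN N → ℝ) (L : RN N → ℝ) (F : RN N → ℝ → ℝ)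
    (uT : RN N → ℝ) (m : RN N → ℝ → ℝ) (w : RN N → ℝ → RN N) : Prop :=
  MemK N T α γ' m₀ m w ∧
    ∀ m' w', MemK N T α γ' m₀ m' w' → energyF N T L F uT m w ≤ energyF N T L F uT m' w'

/-- Classical solution of the MFG system `-∂_t u - Δu + H(∇u) = fc(x,t,m)`,
`∂_t m - Δm - div(∇H(∇u) m) = 0`, `m(·,0) = m₀`, `u(·,T) = u_T`:
`u, m` are continuous on `T^N × [0,T]` together with `∂_t u, ∂_t m` and all first and
second space derivatives, and the equations hold pointwise. -/
structure ClassicalSol (N : ℕ) (T : ℝ) (H : RN N → ℝ) (fc : RN N → ℝ → ℝ → ℝ)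
    (m₀ uT : RN N → ℝ) (u m : RN N → ℝ → ℝ) : Prop where
  per_u : ∀ t, ZPeriodic fun x => u x t
  per_m : ∀ t, ZPeriodic fun x => m x t
  cont_u : ContinuousOn (fun q : RN N × ℝ => u q.1 q.2) ((Set.univ : Set (RN N)) ×ˢ Icc 0 T)
  cont_m : ContinuousOn (fun q : RN N × ℝ => m q.1 q.2) ((Set.univ : Set (RN N)) ×ˢ Icc 0 T)
  cont_ut : ContinuousOn (fun q : RN N × ℝ => deriv (u q.1) q.2)
    ((Set.univ : Set (RN N)) ×ˢ Icc 0 T)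
  cont_mt : ContinuousOn (fun q : RN N × ℝ => deriv (m q.1) q.2)
    ((Set.univ : Set (RN N)) ×ˢ Icc 0 T)
  cont_du : ∀ i, ContinuousOn (fun q : RN N × ℝ => pd i (fun y => u y q.2) q.1)
    ((Set.univ : Set (RN N)) ×ˢ Icc 0 T)
  cont_dm : ∀ i, ContinuousOn (fun q : RN N × ℝ => pd i (fun y => m y q.2) q.1)
    ((Set.univ : Set (RN N)) ×ˢ Icc 0 T)
  cont_ddu : ∀ i j, ContinuousOn (fun q : RN N × ℝ => pd i (pd j fun y => u y q.2) q.1)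
    ((Set.univ : Set (RN N)) ×ˢ Icc 0 T)
  cont_ddm : ∀ i j, ContinuousOn (fun q : RN N × ℝ => pd i (pd j fun y => m y q.2) q.1)
    ((Set.univ : Set (RN N)) ×ˢ Icc 0 T)
  tdiff_u : ∀ x, ∀ t ∈ Ioo 0 T, DifferentiableAt ℝ (u x) t
  tdiff_m : ∀ x, ∀ t ∈ Ioo 0 T, DifferentiableAt ℝ (m x) t
  xdiff_u : ∀ t ∈ Icc 0 T,
    Differentiable ℝ (fun y => u y t) ∧ ∀ i, Differentiable ℝ (pd i fun y => u y t)
  xdiff_m : ∀ t ∈ Icc 0 T,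
    Differentiable ℝ (fun y => m y t) ∧ ∀ i, Differentiable ℝ (pd i fun y => m y t)
  hjb : ∀ x, ∀ t ∈ Ioo 0 T,
    -deriv (u x) t - lap (fun y => u y t) x + H (grad (fun y => u y t) x) = fc x t (m x t)
  fkp : ∀ x, ∀ t ∈ Ioo 0 T,
    deriv (m x) t - lap (fun y => m y t) x
      - dive (fun y => m y t • grad H (grad (fun z => u z t) y)) x = 0
  init : ∀ x, m x 0 = m₀ x
  final : ∀ x, u x T = uT x

/-- Weak solution `(u,m)` (with weak spatial gradient `Du` of `u`) of the MFG system
`-∂_t u - Δu + H(∇u) = fc(x,t,m)`, `∂_t m - Δm - div(∇H(∇u) m) = 0`, `m(·,0) = m₀`,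
`u(·,T) = u_T`, in the sense of Definition 3.1 of the paper. -/
structure WeakSol (N : ℕ) (T γ α : ℝ) (H : RN N → ℝ) (fc : RN N → ℝ → ℝ → ℝ)
    (m₀ uT : RN N → ℝ) (u m : RN N → ℝ → ℝ) (Du : RN N → ℝ → RN N) : Prop where
  per_u : ∀ t, ZPeriodic fun x => u x t
  per_m : ∀ t, ZPeriodic fun x => m x t
  per_Du : ∀ t, ZPeriodic fun x => Du x t
  nonneg_m : ∀ x t, 0 ≤ m x t
  lp_m : IntegrableOn (fun q : RN N × ℝ => m q.1 q.2 ^ (α + 1)) (QQ N T)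
  lq_u_sup : α < γ / N → ∃ C, ∀ᵐ q ∂(volume.restrict (QQ N T)), |u q.1 q.2| ≤ C
  lq_u_int : γ / N < α →
    IntegrableOn (fun q : RN N × ℝ =>
      |u q.1 q.2| ^ (γ * (α + 1) * (1 + (N : ℝ)) / (α * N - γ))) (QQ N T)
  weak_grad : HasWeakGradQ N T u Du
  lγ_Du : IntegrableOn (fun q : RN N × ℝ => euclNorm (Du q.1 q.2) ^ γ) (QQ N T)
  int_mL : IntegrableOn (fun q : RN N × ℝ =>
      m q.1 q.2 * Leg H (grad H (Du q.1 q.2))) (QQ N T)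
  int_mDH : IntegrableOn (fun q : RN N × ℝ => m q.1 q.2 • grad H (Du q.1 q.2)) (QQ N T)
  hjb : ∀ φ : RN N → ℝ → ℝ, IsTest N φ → (∀ x t, 0 ≤ φ x t) →
    (∃ ε > (0:ℝ), ∀ x, ∀ t ≤ ε, φ x t = 0) →
    intQ N T (fun x t => u x t * deriv (φ x) t - u x t * lap (fun y => φ y t) x
        + (H (Du x t) - fc x t (m x t)) * φ x t)
      ≤ ∫ x in cube N, uT x * φ x T
  fkp : ∀ φ : RN N → ℝ → ℝ, IsTest N φ → (∀ x, φ x T = 0) →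
    intQ N T (fun x t => m x t * deriv (φ x) t
        - dotp (m x t • grad H (Du x t)) (grad (fun y => φ y t) x)
        + m x t * lap (fun y => φ y t) x)
      + (∫ x in cube N, m₀ x * φ x 0) = 0
  energy_id : intQ N T (fun x t =>
        m x t * (-(fc x t (m x t)) + Leg H (grad H (Du x t))))
      + (∫ x in cube N, (m x T * uT x - m₀ x * u x 0)) = 0

/-- Nonnegative weak solution of the Fokker–Planck equation
`∂_t m - Δm + div(A m) = 0` in `Q`, `m(·,0) = m₀`, with finite energy
`E = ∫_Q |A|^{γ'} m < ∞`. -/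
structure FPSol (N : ℕ) (T γ' : ℝ) (m₀ : RN N → ℝ) (m : RN N → ℝ → ℝ)
    (A : RN N → ℝ → RN N) : Prop where
  per_m : ∀ t, ZPeriodic fun x => m x t
  per_A : ∀ t, ZPeriodic fun x => A x t
  nonneg : ∀ x t, 0 ≤ m x t
  int_m : IntegrableOn (fun q : RN N × ℝ => m q.1 q.2) (QQ N T)
  int_E : IntegrableOn (fun q : RN N × ℝ => euclNorm (A q.1 q.2) ^ γ' * m q.1 q.2) (QQ N T)
  weak : ∀ φ : RN N → ℝ → ℝ, IsTest N φ → (∀ x, φ x T = 0) →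
    intQ N T (fun x t => m x t * (deriv (φ x) t + lap (fun y => φ y t) x
        + dotp (A x t) (grad (fun y => φ y t) x)))
      + (∫ x in cube N, m₀ x * φ x 0) = 0

/-- Conditions on the initial datum of the Fokker–Planck equation: a periodic (i.e.
defined on the torus) Lipschitz probability density, with `‖∇m₀‖_∞ ≤ K₀`. -/
def FPData (N : ℕ) (K₀ : ℝ) (m₀ : RN N → ℝ) : Prop :=
  ZPeriodic m₀ ∧ (∀ x, 0 ≤ m₀ x) ∧ (∫ x in cube N, m₀ x) = 1 ∧
    Differentiable ℝ m₀ ∧ ∀ x, euclNorm (grad m₀ x) ≤ K₀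

open scoped ENNReal ContDiff

section Torus

variable {N : ℕ}

lemma fundamentalDomain_ae_eq_cube (N : ℕ) :
    (ZSpan.fundamentalDomain (Pi.basisFun ℝ (Fin N)) : Set (RN N)) =ᵐ[volume] cube N := by
  have hD : ZSpan.fundamentalDomain (Pi.basisFun ℝ (Fin N))
      = Set.univ.pi fun _ : Fin N => Ico (0 : ℝ) 1 := by
    ext x; simp [ZSpan.mem_fundamentalDomain]
  rw [hD]
  exact Measure.univ_pi_Ico_ae_eq_Icc (f := (0 : RN N)) (g := (1 : RN N))

lemma ZPeriodic.vadd_lattice_eq {β : Type*} {F : RN N → β} (hF : ZPeriodic F)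
    (g : Submodule.span ℤ (Set.range (Pi.basisFun ℝ (Fin N)))) (x : RN N) :
    F (g +ᵥ x) = F x := by
  obtain ⟨g, hg⟩ := g
  have hg' := hg
  rw [Module.Basis.mem_span_iff_repr_mem] at hg'
  choose z hz using hg'
  have : (⟨g, hg⟩ : Submodule.span ℤ (Set.range (Pi.basisFun ℝ (Fin N)))) +ᵥ x
      = fun i => x i + (z i : ℝ) := by
    ext i
    have := hz i
    simp at this
    simp [Submodule.vadd_def, this, add_comm]
  rw [this, hF]

instance vaddInvariantMeasure_lattice (N : ℕ) : VAddInvariantMeasure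
    (Submodule.span ℤ (Set.range (Pi.basisFun ℝ (Fin N)))) (RN N) volume :=
  ⟨fun c s _ => measure_preimage_add volume (c : RN N) s⟩

lemma setIntegral_cube_add {F : RN N → ℝ} (hF : ZPeriodic F) (v : RN N) :
    ∫ x in cube N, F (v + x) = ∫ x in cube N, F x := by
  have h := ZSpan.isAddFundamentalDomain (Pi.basisFun ℝ (Fin N)) (volume : Measure (RN N))
  rw [← Measure.restrict_congr_set (fundamentalDomain_ae_eq_cube N)]
  rw [← (h.vadd_of_comm v).setIntegral_eq h (f := F) hF.vadd_lattice_eq]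
  have := (measurePreserving_add_left (volume : Measure (RN N)) v).setIntegral_image_emb
    (measurableEmbedding_addLeft v) F (ZSpan.fundamentalDomain (Pi.basisFun ℝ (Fin N)))
  rw [← this]
  rfl

lemma isCompact_cube (N : ℕ) : IsCompact (cube N) := isCompact_Icc

lemma volume_cube (N : ℕ) : volume (cube N) = 1 := by
  simp [cube, Real.volume_Icc_pi]

lemma measurableSet_QQ (N : ℕ) (T : ℝ) : MeasurableSet (QQ N T) :=
  measurableSet_Icc.prod measurableSet_Ioo

lemma volume_QQ (N : ℕ) (T : ℝ) : volume (QQ N T) = ENNReal.ofReal T := by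
  rw [QQ, Measure.volume_eq_prod, Measure.prod_prod, volume_cube, Real.volume_Ioo]; simp

lemma volume_restrict_QQ (N : ℕ) (T : ℝ) :
    (volume : Measure (RN N × ℝ)).restrict (QQ N T)
      = (volume.restrict (cube N)).prod (volume.restrict (Ioo 0 T)) := by
  rw [QQ, Measure.volume_eq_prod, Measure.prod_restrict]

instance isFiniteMeasure_restrict_cube (N : ℕ) :
    IsFiniteMeasure ((volume : Measure (RN N)).restrict (cube N)) :=
  ⟨by simp [volume_cube]⟩

instance isFiniteMeasure_restrict_QQ (N : ℕ) (T : ℝ) :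
    IsFiniteMeasure ((volume : Measure (RN N × ℝ)).restrict (QQ N T)) :=
  ⟨by simp [volume_QQ]⟩

lemma ContinuousOn.integrableOn_QQ {T : ℝ} {F : RN N × ℝ → ℝ}
    (hF : ContinuousOn F (cube N ×ˢ Icc 0 T)) : IntegrableOn F (QQ N T) :=
  (hF.integrableOn_compact ((isCompact_cube N).prod isCompact_Icc)).mono_set
    (Set.prod_mono subset_rfl Ioo_subset_Icc_self)

/-- Every point of `ℝ^N` is an integer translate of a point of the unit cube. -/
lemma exists_fract_mem_cube (x : RN N) :
    (fun i => x i + ((-⌊x i⌋ : ℤ) : ℝ)) ∈ cube N := by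
  constructor <;> intro i <;> simp only [Pi.zero_apply, Pi.one_apply, Int.cast_neg]
  · linarith [Int.floor_le (x i)]
  · linarith [Int.lt_floor_add_one (x i)]

lemma ZPeriodic.exists_bound {u : RN N → ℝ} (hu : ZPeriodic u) (hc : Continuous u) :
    ∃ C, 0 ≤ C ∧ ∀ x, |u x| ≤ C := by
  obtain ⟨C, hC⟩ := (isCompact_cube N).exists_bound_of_continuousOn hc.continuousOn
  refine ⟨max C 0, le_max_right _ _, fun x => ?_⟩
  rw [← hu x (fun i => -⌊x i⌋)]
  exact (hC _ (exists_fract_mem_cube x)).trans (le_max_left _ _)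

lemma integral_cube_fderiv_eq_zero {u : RN N → ℝ} (hu : ZPeriodic u) (hc : ContDiff ℝ 1 u)
    (i : Fin N) : ∫ x in cube N, pd i u x = 0 := by
  have hcont : Continuous (pd i u) := (hc.continuous_fderiv one_ne_zero).clm_apply continuous_const
  have hper : ZPeriodic (pd i u) := by
    intro x z
    unfold pd
    have : (fun y : RN N => u (y + fun i => (z i : ℝ))) = u := funext fun y => hu y z
    conv_rhs => rw [← this]
    rw [fderiv_comp_add_right]
    rfl
  have h1 : ∀ x, ∫ s in (0:ℝ)..1, pd i u (s • Pi.single i (1:ℝ) + x) = 0 := by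
    intro x
    have hd : ∀ s ∈ uIcc (0:ℝ) 1, HasDerivAt (fun s : ℝ => u (s • Pi.single i (1:ℝ) + x))
        (pd i u (s • Pi.single i (1:ℝ) + x)) s := by
      intro s _
      have h0 : HasDerivAt (fun s : ℝ => s • (Pi.single i (1:ℝ) : RN N) + x)
          (Pi.single i (1:ℝ)) s := by
        simpa using ((hasDerivAt_id s).smul_const (Pi.single i (1:ℝ) : RN N)).add_const x
      exact ((hc.differentiable one_ne_zero) _).hasFDerivAt.comp_hasDerivAt s h0
    rw [intervalIntegral.integral_eq_sub_of_hasDerivAt hd]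
    · have := hu x (Pi.single i 1)
      rw [sub_eq_zero, zero_smul, zero_add, ← this]
      congr 1
      ext j
      by_cases h : j = i
      · subst h; simp [add_comm]
      · simp [h]
    · exact (hcont.comp (by fun_prop)).intervalIntegrable _ _
  have h2 : ∫ x in cube N, ∫ s in (0:ℝ)..1, pd i u (s • Pi.single i (1:ℝ) + x) = 0 := by
    simp [h1]
  rw [← MeasureTheory.intervalIntegral_integral_swap] at h2
  · simp_rw [setIntegral_cube_add hper] at h2
    simpa using h2
  · have hc2 : Continuous fun p : ℝ × RN N => pd i u (p.1 • Pi.single i (1:ℝ) + p.2) :=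
      hcont.comp (by fun_prop)
    rw [Measure.prod_restrict]
    exact (hc2.continuousOn.integrableOn_compact
      ((isCompact_Icc (a := (0:ℝ)) (b := 1)).prod (isCompact_cube N))).mono_set
      (Set.prod_mono (by rw [uIoc_of_le zero_le_one]; exact Ioc_subset_Icc_self) subset_rfl)

end Torus

section PeriodicKernels

variable {N : ℕ} {T : ℝ}

/-- Smooth functions on `ℝ^N × ℝ`, `ℤ^N`-periodic in space and supported in times `[0,T]`. -/
structure PerSupp (T : ℝ) {F : Type} [NormedAddCommGroup F] [NormedSpace ℝ F]
    (g : RN N × ℝ → F) : Prop where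
  smooth : ContDiff ℝ ∞ g
  per : ∀ (p : RN N × ℝ) (z : Fin N → ℤ), g (p + ((fun i => (z i : ℝ)), 0)) = g p
  supp : ∀ p : RN N × ℝ, p.2 ∉ Icc 0 T → g p = 0

variable {F : Type} [NormedAddCommGroup F] [NormedSpace ℝ F] {g : RN N × ℝ → F}

lemma PerSupp.exists_bound (hg : PerSupp T g) : ∃ C, 0 ≤ C ∧ ∀ p, ‖g p‖ ≤ C := by
  obtain ⟨C, hC⟩ := ((isCompact_cube N).prod (isCompact_Icc (a := 0) (b := T))
    ).exists_bound_of_continuousOn hg.smooth.continuous.continuousOn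
  refine ⟨max C 0, le_max_right _ _, fun p => ?_⟩
  by_cases hp : p.2 ∈ Icc 0 T
  · rw [← hg.per p (fun i => -⌊p.1 i⌋)]
    refine (hC _ ⟨exists_fract_mem_cube p.1, ?_⟩).trans (le_max_left _ _)
    simpa using hp
  · simp [hg.supp p hp]

lemma PerSupp.fderiv (hg : PerSupp T g) : PerSupp T (fderiv ℝ g) where
  smooth := hg.smooth.fderiv_right (by simp)
  per p z := by
    have : (fun y : RN N × ℝ => g (y + ((fun i => (z i : ℝ)), 0))) = g :=
      funext fun y => hg.per y z
    conv_rhs => rw [← this]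
    rw [fderiv_comp_add_right]
  supp p hp := by
    have ho : IsOpen {q : RN N × ℝ | q.2 ∉ Icc 0 T} :=
      (isClosed_Icc.preimage continuous_snd).isOpen_compl
    have : g =ᶠ[𝓝 p] fun _ => 0 := by
      filter_upwards [ho.mem_nhds hp] with q hq using hg.supp q hq
    rw [this.fderiv_eq]; simp

lemma PerSupp.fderiv_apply (hg : PerSupp T g) (e : RN N × ℝ) :
    PerSupp T (fun p => _root_.fderiv ℝ g p e) where
  smooth := hg.fderiv.smooth.clm_apply contDiff_const
  per p z := by rw [hg.fderiv.per]
  supp p hp := by rw [hg.fderiv.supp p hp]; simp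

lemma PerSupp.add {g' : RN N × ℝ → F} (hg : PerSupp T g) (hg' : PerSupp T g') :
    PerSupp T (fun p => g p + g' p) where
  smooth := hg.smooth.add hg'.smooth
  per p z := by rw [hg.per, hg'.per]
  supp p hp := by rw [hg.supp p hp, hg'.supp p hp, add_zero]

lemma PerSupp.sum {ι : Type} (s : Finset ι) {g : ι → RN N × ℝ → F}
    (hg : ∀ i ∈ s, PerSupp T (g i)) : PerSupp T (fun p => ∑ i ∈ s, g i p) where
  smooth := ContDiff.sum fun i hi => (hg i hi).smooth
  per p z := Finset.sum_congr rfl fun i hi => (hg i hi).per p z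
  supp p hp := Finset.sum_eq_zero fun i hi => (hg i hi).supp p hp

variable {Ω : Type} [MeasurableSpace Ω] {ν : Measure Ω} {κ : Ω → ℝ} {v : Ω → RN N × ℝ}

/-- The weighted average `p ↦ ∫ κ(a) g(p + v(a)) dν(a)` of translates of `g`. -/
def kerInt (ν : Measure Ω) (κ : Ω → ℝ) (v : Ω → RN N × ℝ) (g : RN N × ℝ → F)
    (p : RN N × ℝ) : F :=
  ∫ a, κ a • g (p + v a) ∂ν

lemma PerSupp.integrable_kerInt (hg : PerSupp T g) (hκ : Integrable κ ν) (hv : Measurable v)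
    (p : RN N × ℝ) : Integrable (fun a => κ a • g (p + v a)) ν := by
  obtain ⟨C, -, hC⟩ := hg.exists_bound
  refine hκ.smul_bdd C ?_ (ae_of_all _ fun a => hC _)
  have := hg.smooth.continuous.stronglyMeasurable
  exact (this.comp_measurable (by fun_prop)).aestronglyMeasurable

lemma PerSupp.hasFDerivAt_kerInt (hg : PerSupp T g) (hκ : Integrable κ ν) (hv : Measurable v)
    (p : RN N × ℝ) : HasFDerivAt (kerInt ν κ v g) (kerInt ν κ v (_root_.fderiv ℝ g) p) p := by
  obtain ⟨C, -, hC⟩ := hg.fderiv.exists_bound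
  refine hasFDerivAt_integral_of_dominated_of_fderiv_le (s := univ)
    (bound := fun a => ‖κ a‖ * C)
    (F' := fun p a => κ a • _root_.fderiv ℝ g (p + v a)) univ_mem ?_
    (hg.integrable_kerInt hκ hv p) ?_ ?_ (hκ.norm.mul_const C) ?_
  · exact Eventually.of_forall fun q => (hg.integrable_kerInt hκ hv q).aestronglyMeasurable
  · exact (hg.fderiv.integrable_kerInt hκ hv p).aestronglyMeasurable
  · refine ae_of_all _ fun a q _ => ?_
    rw [norm_smul]
    exact mul_le_mul_of_nonneg_left (hC _) (norm_nonneg _)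
  · refine ae_of_all _ fun a q _ => ?_
    have h := ((hg.smooth.differentiable (by simp)) (q + v a)).hasFDerivAt
    exact ((hasFDerivAt_comp_add_right (v a)).2 h).const_smul (κ a)

lemma PerSupp.contDiff_nat_kerInt (hκ : Integrable κ ν) (hv : Measurable v) (n : ℕ) :
    ∀ {F : Type} [NormedAddCommGroup F] [NormedSpace ℝ F] {g : RN N × ℝ → F},
      PerSupp T g → ContDiff ℝ n (kerInt ν κ v g) := by
  induction n with
  | zero =>
    intro F _ _ g hg
    exact contDiff_zero.2 (continuous_iff_continuousAt.2 fun p =>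
      (hg.hasFDerivAt_kerInt hκ hv p).continuousAt)
  | succ n ih =>
    intro F _ _ g hg
    have hd : _root_.fderiv ℝ (kerInt ν κ v g) = kerInt ν κ v (_root_.fderiv ℝ g) :=
      funext fun p => (hg.hasFDerivAt_kerInt hκ hv p).fderiv
    push_cast
    rw [contDiff_succ_iff_fderiv]
    refine ⟨fun p => (hg.hasFDerivAt_kerInt hκ hv p).differentiableAt, by simp, ?_⟩
    rw [hd]
    exact ih hg.fderiv

lemma PerSupp.contDiff_kerInt (hg : PerSupp T g) (hκ : Integrable κ ν) (hv : Measurable v) :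
    ContDiff ℝ ∞ (kerInt ν κ v g) :=
  contDiff_infty.2 fun n => PerSupp.contDiff_nat_kerInt hκ hv n hg

lemma PerSupp.fderiv_kerInt_apply [CompleteSpace F] (hg : PerSupp T g) (hκ : Integrable κ ν)
    (hv : Measurable v) (p e : RN N × ℝ) :
    _root_.fderiv ℝ (kerInt ν κ v g) p e
      = kerInt ν κ v (fun q => _root_.fderiv ℝ g q e) p := by
  rw [(hg.hasFDerivAt_kerInt hκ hv p).fderiv, kerInt,
    ContinuousLinearMap.integral_apply (hg.fderiv.integrable_kerInt hκ hv p)]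
  rfl

lemma PerSupp.kerInt_periodic (hg : PerSupp T g) (t : ℝ) :
    ZPeriodic fun x => kerInt ν κ v g (x, t) := by
  intro x z
  simp only [kerInt]
  congr 1
  ext a
  rw [← hg.per ((x, t) + v a) z]
  congr 2
  ext <;> simp [add_right_comm]

lemma PerSupp.periodic (hg : PerSupp T g) (t : ℝ) : ZPeriodic fun x => g (x, t) := by
  intro x z
  have := hg.per (x, t) z
  simpa [Pi.add_def] using this

end PeriodicKernels

section GaussianKernel

variable {N : ℕ} {T : ℝ}

/-- The unnormalised Gaussian weight `exp(-a|z|²)` on `ℝ^N`. -/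
def gk (a : ℝ) (z : RN N) : ℝ := Real.exp (-a * ∑ i, z i ^ 2)

lemma gk_pos (a : ℝ) (z : RN N) : 0 < gk a z := Real.exp_pos _

lemma continuous_gk (a : ℝ) : Continuous (gk (N := N) a) := by
  unfold gk; fun_prop

lemma integrable_gk {a : ℝ} (ha : 0 < a) : Integrable (gk (N := N) a) := by
  have h : Integrable (fun z : RN N => ∏ i, Real.exp (-a * z i ^ 2)) :=
    Integrable.fintype_prod (f := fun _ (x : ℝ) => Real.exp (-a * x ^ 2))
      fun _ => integrable_exp_neg_mul_sq ha
  refine h.congr (ae_of_all _ fun z => ?_)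
  rw [gk, Finset.mul_sum, Real.exp_sum]

lemma norm_sq_le_sum_sq (z : RN N) : ‖z‖ ^ 2 ≤ ∑ i, z i ^ 2 := by
  have h0 : 0 ≤ ∑ i, z i ^ 2 := Finset.sum_nonneg fun i _ => sq_nonneg _
  rw [← Real.le_sqrt (norm_nonneg _) h0, pi_norm_le_iff_of_nonneg (Real.sqrt_nonneg _)]
  intro i
  rw [Real.norm_eq_abs, ← Real.sqrt_sq_eq_abs]
  exact Real.sqrt_le_sqrt
    (Finset.single_le_sum (f := fun i => z i ^ 2) (fun i _ => sq_nonneg _) (Finset.mem_univ i))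

lemma norm_mul_gk_le (z : RN N) : ‖z‖ * gk (1 / 4) z ≤ 2 * gk (1 / 8) z := by
  have h1 : ‖z‖ ≤ 2 * Real.exp (1 / 8 * ∑ i, z i ^ 2) := by
    have := Real.add_one_le_exp (1 / 8 * ∑ i, z i ^ 2)
    have := norm_sq_le_sum_sq z
    nlinarith [sq_nonneg (‖z‖ - 4)]
  calc ‖z‖ * gk (1 / 4) z
      ≤ 2 * Real.exp (1 / 8 * ∑ i, z i ^ 2) * gk (1 / 4) z :=
        mul_le_mul_of_nonneg_right h1 (gk_pos _ _).le
    _ = 2 * gk (1 / 8) z := by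
        rw [mul_assoc, gk, gk, ← Real.exp_add]; congr 2; ring

lemma integrable_norm_mul_gk : Integrable (fun z : RN N => ‖z‖ * gk (1 / 4) z) := by
  refine ((integrable_gk (N := N) (a := 1 / 8) (by norm_num)).const_mul 2).mono'
    (continuous_norm.mul (continuous_gk _)).aestronglyMeasurable (ae_of_all _ fun z => ?_)
  rw [Real.norm_of_nonneg (mul_nonneg (norm_nonneg _) (gk_pos _ _).le)]
  exact norm_mul_gk_le z

lemma integrable_coord_mul_gk (i : Fin N) : Integrable (fun z : RN N => z i * gk (1 / 4) z) := by
  refine integrable_norm_mul_gk.mono'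
    ((continuous_apply i).mul (continuous_gk _)).aestronglyMeasurable (ae_of_all _ fun z => ?_)
  rw [norm_mul, Real.norm_of_nonneg (gk_pos _ _).le]
  exact mul_le_mul_of_nonneg_right (norm_le_pi_norm z i) (gk_pos _ _).le

lemma differentiable_gk (a : ℝ) : Differentiable ℝ (gk (N := N) a) := by
  unfold gk; fun_prop

lemma fderiv_gk (a : ℝ) (z : RN N) (i : Fin N) :
    fderiv ℝ (gk a) z (Pi.single i 1) = -2 * a * z i * gk a z := by
  have h : HasFDerivAt (fun z : RN N => ∑ j, z j ^ 2)
      (∑ j, (2 * z j) • (ContinuousLinearMap.proj j : RN N →L[ℝ] ℝ)) z := by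
    refine HasFDerivAt.fun_sum fun j _ => ?_
    have := ((ContinuousLinearMap.proj (R := ℝ) (φ := fun _ : Fin N => ℝ) j).hasFDerivAt
      (x := z)).pow 2
    simpa using this
  have h2 := (h.const_mul (-a)).exp
  have h3 : HasFDerivAt (gk (N := N) a) _ z := h2
  rw [h3.fderiv]
  simp [Pi.single_apply, gk]
  ring

/-- Gaussian integration by parts. -/
lemma integral_coord_mul_gk_mul {u : RN N → ℝ} (hu : ContDiff ℝ 1 u) (i : Fin N) {C C' : ℝ}
    (hC : ∀ z, |u z| ≤ C) (hC' : ∀ z, |fderiv ℝ u z (Pi.single i 1)| ≤ C') :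
    ∫ z, z i * gk (1 / 4) z * u z = 2 * ∫ z, gk (1 / 4) z * fderiv ℝ u z (Pi.single i 1) := by
  have hcd : Continuous fun z => fderiv ℝ u z (Pi.single i 1) :=
    (hu.continuous_fderiv one_ne_zero).clm_apply continuous_const
  have h1 : Integrable fun z : RN N => z i * gk (1 / 4) z * u z :=
    (integrable_coord_mul_gk i).mul_bdd (c := C) hu.continuous.aestronglyMeasurable (ae_of_all _ hC)
  have hg := integrable_gk (N := N) (a := 1 / 4) (by norm_num)
  have := integral_mul_fderiv_eq_neg_fderiv_mul_of_integrable (f := gk (N := N) (1 / 4)) (g := u)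
    (v := Pi.single i 1) (μ := volume) ?_
    (hg.mul_bdd (c := C') hcd.aestronglyMeasurable (ae_of_all _ hC'))
    (hg.mul_bdd (c := C) hu.continuous.aestronglyMeasurable (ae_of_all _ hC))
    (fun x _ => differentiable_gk _ x) (fun x _ => hu.differentiable one_ne_zero x)
  · rw [this, ← integral_neg, ← integral_const_mul]
    refine integral_congr_ae (ae_of_all _ fun z => ?_)
    simp only [fderiv_gk]
    ring
  · refine (h1.const_mul (-2⁻¹)).congr (ae_of_all _ fun z => ?_)
    simp only [fderiv_gk]
    ring

end GaussianKernel

section HeatFlow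

variable {N : ℕ} {T : ℝ} {g : RN N × ℝ → ℝ}

/-- The `i`-th spatial unit vector of `ℝ^N × ℝ`. -/
def spaceDir (i : Fin N) : RN N × ℝ := (Pi.single i 1, 0)

/-- The total mass of the Gaussian weight. -/
def gkMass (N : ℕ) : ℝ := ∫ z : RN N, gk (1 / 4) z

lemma gkMass_pos (N : ℕ) : 0 < gkMass N :=
  integral_exp_pos (integrable_gk (N := N) (a := 1 / 4) (by norm_num))

/-- Gaussian average at parabolic scale `√s`, evaluated at a time shifted by `s`. -/
def heatAvg (s : ℝ) (g : RN N × ℝ → ℝ) (p : RN N × ℝ) : ℝ :=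
  kerInt volume (gk (1 / 4)) (fun z : RN N => (√s • z, s)) g p

/-- The backward heat operator `∂_t + Δ`. -/
def heatOp (g : RN N × ℝ → ℝ) (p : RN N × ℝ) : ℝ :=
  fderiv ℝ g p (0, 1) + ∑ i, fderiv ℝ (fun q => fderiv ℝ g q (spaceDir i)) p (spaceDir i)

lemma PerSupp.heatOp (hg : PerSupp T g) : PerSupp T (heatOp g) :=
  (hg.fderiv_apply _).add (PerSupp.sum _ fun _ _ => (hg.fderiv_apply _).fderiv_apply _)

lemma integrable_gk_quarter : Integrable (gk (N := N) (1 / 4)) := integrable_gk (by norm_num)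

lemma measurable_shift (s : ℝ) : Measurable fun z : RN N => (√s • z, s) := by fun_prop

lemma heatAvg_zero (g : RN N × ℝ → ℝ) (p : RN N × ℝ) : heatAvg 0 g p = gkMass N * g p := by
  have : ∀ z : RN N, p + (√0 • z, (0:ℝ)) = p := fun z => by simp
  simp only [heatAvg, kerInt, this, smul_eq_mul, integral_mul_const, gkMass]

lemma PerSupp.continuous_heatAvg (hg : PerSupp T g) (p : RN N × ℝ) :
    Continuous fun s => heatAvg s g p := by
  obtain ⟨C, -, hC⟩ := hg.exists_bound
  refine continuous_of_dominated (bound := fun z => gk (1 / 4) z * C) ?_ ?_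
    (integrable_gk_quarter.mul_const C) ?_
  · exact fun s => (hg.integrable_kerInt integrable_gk_quarter
      (measurable_shift s) p).aestronglyMeasurable
  · refine fun s => ae_of_all _ fun z => ?_
    rw [norm_smul, Real.norm_of_nonneg (gk_pos _ _).le]
    exact mul_le_mul_of_nonneg_left (hC _) (gk_pos _ _).le
  · refine ae_of_all _ fun z => ?_
    have := hg.smooth.continuous
    fun_prop

lemma PerSupp.slice_contDiff (hg : PerSupp T g) (s : ℝ) (p : RN N × ℝ) :
    ContDiff ℝ 1 fun z : RN N => g (p + (√s • z, s)) :=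
  (hg.smooth.of_le (by simp)).comp (by fun_prop)

lemma PerSupp.slice_fderiv (hg : PerSupp T g) (s : ℝ) (p : RN N × ℝ) (z : RN N) (i : Fin N) :
    _root_.fderiv ℝ (fun z : RN N => g (p + (√s • z, s))) z (Pi.single i 1)
      = √s * _root_.fderiv ℝ g (p + (√s • z, s)) (spaceDir i) := by
  have h1 : HasFDerivAt (fun z : RN N => p + (√s • z, s))
      ((√s • ContinuousLinearMap.id ℝ (RN N)).prod (0 : RN N →L[ℝ] ℝ)) z := by
    refine HasFDerivAt.const_add _ (HasFDerivAt.prodMk ?_ (hasFDerivAt_const _ _))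
    exact (hasFDerivAt_id z).const_smul (√s)
  have h2 := ((hg.smooth.differentiable (by simp)) (p + (√s • z, s))).hasFDerivAt.comp z h1
  have h3 : HasFDerivAt (fun z : RN N => g (p + (√s • z, s))) _ z := h2
  rw [h3.fderiv]
  have : (√s • (Pi.single i (1:ℝ) : RN N), (0:ℝ)) = √s • spaceDir i := by simp [spaceDir]
  simp [this]

lemma PerSupp.integral_coord_mul_slice (hg : PerSupp T g) {s : ℝ} (p : RN N × ℝ)
    (i : Fin N) :
    ∫ z : RN N, z i * gk (1 / 4) z * g (p + (√s • z, s))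
      = 2 * √s * heatAvg s (fun q => _root_.fderiv ℝ g q (spaceDir i)) p := by
  obtain ⟨C, -, hC⟩ := hg.exists_bound
  obtain ⟨C', -, hC'⟩ := (hg.fderiv_apply (spaceDir i)).exists_bound
  rw [integral_coord_mul_gk_mul (hg.slice_contDiff s p) i (C := C) (C' := √s * C')
    (fun z => hC _), mul_assoc, heatAvg, kerInt, ← integral_const_mul (√s)]
  · congr 1
    refine integral_congr_ae (ae_of_all _ fun z => ?_)
    simp only [hg.slice_fderiv, smul_eq_mul]
    ring
  · intro z
    rw [hg.slice_fderiv, abs_mul, abs_of_nonneg (Real.sqrt_nonneg s)]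
    exact mul_le_mul_of_nonneg_left (hC' _) (Real.sqrt_nonneg s)

lemma clm_apply_eq_sum (A : RN N × ℝ →L[ℝ] ℝ) (z : RN N) (r : ℝ) :
    A (z, r) = r * A (0, 1) + ∑ i, z i * A (spaceDir i) := by
  have : (z, r) = r • ((0 : RN N), (1:ℝ)) + ∑ i, z i • spaceDir i := by
    have h : ∑ i, z i • spaceDir i = (z, (0:ℝ)) := by
      ext j
      · simp [spaceDir, Prod.fst_sum, Finset.sum_apply, Pi.single_apply]
      · simp [spaceDir, Prod.snd_sum]
    rw [h]; simp
  rw [this]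
  simp only [map_add, map_smul, map_sum, smul_eq_mul]

lemma PerSupp.hasDerivAt_heatAvg (hg : PerSupp T g) (p : RN N × ℝ) {s : ℝ} (hs : 0 < s) :
    HasDerivAt (fun s => heatAvg s g p) (heatAvg s (_root_.heatOp g) p) s := by
  obtain ⟨C, hC0, hC⟩ := hg.fderiv.exists_bound
  have hcf := hg.fderiv.smooth.continuous
  have key := hasDerivAt_integral_of_dominated_loc_of_deriv_le (μ := (volume : Measure (RN N)))
    (F := fun s z => gk (1 / 4) z • g (p + (√s • z, s)))
    (F' := fun s z => gk (1 / 4) z * _root_.fderiv ℝ g (p + (√s • z, s)) ((1 / (2 * √s)) • z, 1))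
    (x₀ := s) (s := Ioi (s / 2))
    (bound := fun z => C * (1 / (2 * √(s / 2))) * (‖z‖ * gk (1 / 4) z) + C * gk (1 / 4) z)
    (Ioi_mem_nhds (by linarith)) ?_ ?_ ?_ ?_ ?_ ?_
  · refine key.2.congr_deriv ?_
    have hs2 : √s ≠ 0 := (Real.sqrt_pos.2 hs).ne'
    have hi0 : ∀ e, Integrable fun z : RN N =>
        gk (1 / 4) z * _root_.fderiv ℝ g (p + (√s • z, s)) e := fun e =>
      (hg.fderiv_apply e).integrable_kerInt integrable_gk_quarter (measurable_shift s) p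
    have hii : ∀ i, Integrable fun z : RN N =>
        z i * gk (1 / 4) z * _root_.fderiv ℝ g (p + (√s • z, s)) (spaceDir i) := fun i =>
      (hg.fderiv_apply (spaceDir i)).integrable_kerInt (integrable_coord_mul_gk i)
        (measurable_shift s) p
    have hiii : ∀ i, Integrable fun z : RN N =>
        gk (1 / 4) z * _root_.fderiv ℝ (fun q => _root_.fderiv ℝ g q (spaceDir i))
          (p + (√s • z, s)) (spaceDir i) := fun i =>
      ((hg.fderiv_apply (spaceDir i)).fderiv_apply (spaceDir i)).integrable_kerInt
        integrable_gk_quarter (measurable_shift s) p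
    have e1 : ∫ z : RN N, gk (1 / 4) z *
          _root_.fderiv ℝ g (p + (√s • z, s)) ((1 / (2 * √s)) • z, 1)
        = (∫ z : RN N, gk (1 / 4) z * _root_.fderiv ℝ g (p + (√s • z, s)) (0, 1))
          + ∑ i, (1 / (2 * √s)) * ∫ z : RN N,
            z i * gk (1 / 4) z * _root_.fderiv ℝ g (p + (√s • z, s)) (spaceDir i) := by
      simp_rw [← integral_const_mul]
      rw [← integral_finsetSum _ fun i _ => (hii i).const_mul _, ← integral_add (hi0 _)
        (integrable_finsetSum _ fun i _ => (hii i).const_mul _)]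
      refine integral_congr_ae (ae_of_all _ fun z => ?_)
      simp only [clm_apply_eq_sum (_root_.fderiv ℝ g (p + (√s • z, s))) ((1 / (2 * √s)) • z) 1,
        mul_add, Finset.mul_sum, one_mul, Pi.smul_apply, smul_eq_mul]
      congr 1
      exact Finset.sum_congr rfl fun i _ => by ring
    rw [e1]
    simp only [heatAvg, kerInt, _root_.heatOp, smul_eq_mul, mul_add, Finset.mul_sum]
    rw [integral_add (hi0 _) (integrable_finsetSum _ fun i _ => hiii i),
      integral_finsetSum _ fun i _ => hiii i]
    congr 1
    refine Finset.sum_congr rfl fun i _ => ?_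
    have := (hg.fderiv_apply (spaceDir i)).integral_coord_mul_slice (s := s) p i
    rw [this, heatAvg, kerInt]
    simp only [smul_eq_mul]
    field_simp
  · exact Eventually.of_forall fun s' => (hg.integrable_kerInt integrable_gk_quarter
      (measurable_shift s') p).aestronglyMeasurable
  · exact hg.integrable_kerInt integrable_gk_quarter (measurable_shift s) p
  · have : Continuous fun z : RN N => gk (1 / 4) z *
        _root_.fderiv ℝ g (p + (√s • z, s)) ((1 / (2 * √s)) • z, 1) :=
      (continuous_gk _).mul ((hcf.comp (by fun_prop)).clm_apply (by fun_prop))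
    exact this.aestronglyMeasurable
  · refine ae_of_all _ fun z s' hs' => ?_
    have hs2 : 0 < √(s / 2) := Real.sqrt_pos.2 (by linarith)
    have hs3 : √(s / 2) ≤ √s' := Real.sqrt_le_sqrt (le_of_lt hs')
    rw [norm_mul, Real.norm_of_nonneg (gk_pos _ _).le]
    have h1 : ‖_root_.fderiv ℝ g (p + (√s' • z, s')) ((1 / (2 * √s')) • z, 1)‖
        ≤ C * (1 / (2 * √(s / 2)) * ‖z‖ + 1) := by
      refine (ContinuousLinearMap.le_of_opNorm_le _ (hC _) _).trans
        (mul_le_mul_of_nonneg_left ?_ hC0)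
      rw [Prod.norm_def]
      refine max_le ?_ ?_
      · have : ‖(1 / (2 * √s')) • z‖ ≤ 1 / (2 * √(s / 2)) * ‖z‖ := by
          rw [norm_smul, Real.norm_of_nonneg (by positivity)]
          gcongr
        exact this.trans (by linarith)
      · have : 0 ≤ 1 / (2 * √(s / 2)) * ‖z‖ := by positivity
        simpa using this
    calc _ ≤ gk (1 / 4) z * (C * (1 / (2 * √(s / 2)) * ‖z‖ + 1)) :=
          mul_le_mul_of_nonneg_left h1 (gk_pos _ _).le
      _ = _ := by ring
  · exact (integrable_norm_mul_gk.const_mul _).add (integrable_gk_quarter.const_mul _)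
  · refine ae_of_all _ fun z s' hs' => ?_
    have hs0 : 0 < s' := lt_trans (by linarith) hs'
    have h1 : HasDerivAt (fun s : ℝ => p + (√s • z, s)) ((1 / (2 * √s')) • z, (1:ℝ)) s' := by
      refine HasDerivAt.const_add _ (HasDerivAt.prodMk ?_ (hasDerivAt_id s'))
      exact (Real.hasDerivAt_sqrt hs0.ne').smul_const z
    have h2 := ((hg.smooth.differentiable (by simp))
      (p + (√s' • z, s'))).hasFDerivAt.comp_hasDerivAt
      s' h1
    exact h2.const_mul _

lemma PerSupp.integral_heatAvg_heatOp (hg : PerSupp T g) (p : RN N × ℝ) {h : ℝ} (hh : 0 ≤ h) :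
    ∫ s in (0:ℝ)..h, heatAvg s (_root_.heatOp g) p = heatAvg h g p - gkMass N * g p := by
  rw [← heatAvg_zero]
  exact intervalIntegral.integral_eq_sub_of_hasDerivAt_of_le hh
    (hg.continuous_heatAvg p).continuousOn
    (fun s hs => hg.hasDerivAt_heatAvg p hs.1)
    ((hg.heatOp.continuous_heatAvg p).intervalIntegrable _ _)

/-- The Duhamel potential `∫_0^h` of Gaussian averages: a solution of the backward heat
equation with source `g` up to a term smoothed at scale `√h`. -/
def duhamel (h : ℝ) (g : RN N × ℝ → ℝ) : RN N × ℝ → ℝ :=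
  kerInt ((volume.restrict (Ioc 0 h)).prod (volume : Measure (RN N)))
    (fun a => gk (1 / 4) a.2) (fun a => (√a.1 • a.2, a.1)) g

lemma measurable_shift_prod : Measurable fun a : ℝ × RN N => (√a.1 • a.2, a.1) := by fun_prop

lemma integrable_gk_prod (h : ℝ) : Integrable (fun a : ℝ × RN N => gk (1 / 4) a.2)
    ((volume.restrict (Ioc 0 h)).prod (volume : Measure (RN N))) :=
  integrable_gk_quarter.comp_snd _

lemma PerSupp.duhamel_eq (hg : PerSupp T g) {h : ℝ} (hh : 0 ≤ h) (p : RN N × ℝ) :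
    duhamel h g p = ∫ s in (0:ℝ)..h, heatAvg s g p := by
  rw [duhamel, kerInt, integral_prod _
    (hg.integrable_kerInt (integrable_gk_prod h) measurable_shift_prod p),
    intervalIntegral.integral_of_le hh]
  rfl

lemma PerSupp.contDiff_duhamel (hg : PerSupp T g) (h : ℝ) : ContDiff ℝ ∞ (duhamel h g) :=
  hg.contDiff_kerInt (integrable_gk_prod h) measurable_shift_prod

lemma PerSupp.fderiv_duhamel (hg : PerSupp T g) (h : ℝ) (p e : RN N × ℝ) :
    _root_.fderiv ℝ (duhamel h g) p e = duhamel h (fun q => _root_.fderiv ℝ g q e) p :=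
  hg.fderiv_kerInt_apply (integrable_gk_prod h) measurable_shift_prod p e

lemma duhamel_add_sum {g₀ : RN N × ℝ → ℝ} {g₁ : Fin N → RN N × ℝ → ℝ} (hg₀ : PerSupp T g₀)
    (hg₁ : ∀ i, PerSupp T (g₁ i)) (h : ℝ) (p : RN N × ℝ) :
    duhamel h (fun q => g₀ q + ∑ i, g₁ i q) p = duhamel h g₀ p + ∑ i, duhamel h (g₁ i) p := by
  have hi := fun i => (hg₁ i).integrable_kerInt (integrable_gk_prod h) measurable_shift_prod p
  simp only [duhamel, kerInt, smul_add, Finset.smul_sum]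
  rw [integral_add (hg₀.integrable_kerInt (integrable_gk_prod h) measurable_shift_prod p)
    (integrable_finsetSum _ fun i _ => hi i), integral_finsetSum _ fun i _ => hi i]

lemma PerSupp.heatOp_duhamel (hg : PerSupp T g) {h : ℝ} (hh : 0 ≤ h) (p : RN N × ℝ) :
    _root_.heatOp (duhamel h g) p = heatAvg h g p - gkMass N * g p := by
  rw [← hg.integral_heatAvg_heatOp p hh, ← hg.heatOp.duhamel_eq hh]
  have h1 : ∀ i, (fun q => _root_.fderiv ℝ (duhamel h g) q (spaceDir i))
      = duhamel h (fun q => _root_.fderiv ℝ g q (spaceDir i)) := fun i =>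
    funext fun q => hg.fderiv_duhamel h q _
  simp only [_root_.heatOp, h1]
  rw [hg.fderiv_duhamel]
  simp_rw [fun i => (hg.fderiv_apply (spaceDir i)).fderiv_duhamel h p (spaceDir i)]
  exact (duhamel_add_sum (hg.fderiv_apply _)
    (fun i => (hg.fderiv_apply (spaceDir i)).fderiv_apply (spaceDir i)) h p).symm

end HeatFlow

section KernelBounds

variable {N : ℕ} {T : ℝ} {g : RN N × ℝ → ℝ}

/-- The constant in the on-diagonal heat kernel bound on the torus. -/
def gkConst (N : ℕ) : ℝ := Real.exp (N / 4) * ∫ z : RN N, gk (1 / 8) z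

lemma gkConst_pos (N : ℕ) : 0 < gkConst N :=
  mul_pos (Real.exp_pos _) (integral_exp_pos (integrable_gk (N := N) (a := 1 / 8) (by norm_num)))

lemma gk_le_gk_sub {u : RN N} (hu : u ∈ cube N) (y : RN N) :
    gk (1 / 4) y ≤ Real.exp (N / 4) * gk (1 / 8) (y - u) := by
  rw [gk, gk, ← Real.exp_add]
  refine Real.exp_le_exp.2 ?_
  have h : ∑ i, (1 / 8 * (y i - u i) ^ 2 - 1 / 4 * y i ^ 2) ≤ ∑ _i : Fin N, (1 / 4 : ℝ) := by
    refine Finset.sum_le_sum fun i _ => ?_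
    have h0 : 0 ≤ u i := hu.1 i
    have h1 : u i ≤ 1 := hu.2 i
    nlinarith [sq_nonneg (y i + u i)]
  rw [Finset.sum_sub_distrib, ← Finset.mul_sum, ← Finset.mul_sum] at h
  simp only [Finset.sum_const, Finset.card_univ, Fintype.card_fin, nsmul_eq_mul] at h
  simp only [Pi.sub_apply]
  linarith

lemma integral_gk_mul_periodic_le {G : RN N → ℝ} (hG : ZPeriodic G) (hc : Continuous G)
    (h0 : ∀ x, 0 ≤ G x) : ∫ y, gk (1 / 4) y * G y ≤ gkConst N * ∫ x in cube N, G x := by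
  obtain ⟨C, -, hC⟩ := hG.exists_bound hc
  have hi : Integrable (fun a : RN N × RN N => gk (1 / 8) a.2 * G (a.2 + a.1))
      ((volume.restrict (cube N)).prod volume) :=
    ((integrable_gk (N := N) (a := 1 / 8) (by norm_num)).comp_snd _).mul_bdd (c := C)
      (by fun_prop) (ae_of_all _ fun a => hC _)
  have hu : ∀ u ∈ cube N, ∫ y, gk (1 / 4) y * G y
      ≤ Real.exp (N / 4) * ∫ y, gk (1 / 8) y * G (y + u) := by
    intro u hu
    have e : ∫ y, gk (1 / 8) y * G (y + u) = ∫ y, gk (1 / 8) (y - u) * G y := by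
      rw [← integral_sub_right_eq_self _ u]; simp
    rw [e, ← integral_const_mul]
    refine integral_mono ?_ ?_ fun y => ?_
    · exact integrable_gk_quarter.mul_bdd (c := C) hc.aestronglyMeasurable (ae_of_all _ hC)
    · refine Integrable.const_mul ?_ _
      exact ((integrable_gk (N := N) (a := 1 / 8) (by norm_num)).comp_sub_right u).mul_bdd (c := C)
        hc.aestronglyMeasurable (ae_of_all _ hC)
    · simp only [← mul_assoc]
      exact mul_le_mul_of_nonneg_right (gk_le_gk_sub hu y) (h0 y)
  have hmain : ∫ _u in cube N, (∫ y, gk (1 / 4) y * G y)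
      ≤ ∫ u in cube N, Real.exp (N / 4) * ∫ y, gk (1 / 8) y * G (y + u) :=
    setIntegral_mono_on (integrable_const _) (hi.integral_prod_left.const_mul _)
      measurableSet_Icc hu
  rw [setIntegral_const, measureReal_def, volume_cube, integral_const_mul,
    integral_integral_swap hi] at hmain
  simp only [integral_const_mul, setIntegral_cube_add hG, integral_mul_const] at hmain
  simpa [gkConst, mul_assoc] using hmain

/-- The integral of `g` over a time slice of the torus. -/
def sliceInt (g : RN N × ℝ → ℝ) (t : ℝ) : ℝ := ∫ x in cube N, g (x, t)

lemma PerSupp.contDiff_sliceInt (hg : PerSupp T g) : ContDiff ℝ ∞ (sliceInt g) := by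
  have h := hg.contDiff_kerInt (ν := volume.restrict (cube N)) (κ := fun _ => (1:ℝ))
    (v := fun x => (x, 0)) (integrable_const _) (by fun_prop)
  have h2 : sliceInt g = fun t => kerInt (volume.restrict (cube N)) (fun _ => (1:ℝ))
      (fun x => (x, 0)) g (0, t) := by
    ext t; simp [sliceInt, kerInt]
  rw [h2]
  exact h.comp (by fun_prop)

lemma PerSupp.integral_cube_shift (hg : PerSupp T g) (t : ℝ) (v : RN N × ℝ) :
    ∫ x in cube N, g ((x, t) + v) = sliceInt g (t + v.2) := by
  rw [sliceInt, ← setIntegral_cube_add (hg.periodic (t + v.2)) v.1]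
  refine integral_congr_ae (ae_of_all _ fun x => ?_)
  simp only
  congr 1
  ext <;> simp [add_comm]

lemma PerSupp.sliceInt_supp (hg : PerSupp T g) {t : ℝ} (ht : t ∉ Icc 0 T) :
    sliceInt g t = 0 := by
  simp [sliceInt, hg.supp (_, t) ht]

lemma PerSupp.integrable_sliceInt (hg : PerSupp T g) : Integrable (sliceInt g) :=
  hg.contDiff_sliceInt.continuous.integrable_of_hasCompactSupport
    (HasCompactSupport.intro (isCompact_Icc (a := 0) (b := T)) fun _ ht => hg.sliceInt_supp ht)

lemma sliceInt_nonneg (h0 : ∀ p, 0 ≤ g p) (t : ℝ) : 0 ≤ sliceInt g t :=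
  integral_nonneg fun _ => h0 _

lemma integral_QQ_eq {F : RN N × ℝ → ℝ} (hF : IntegrableOn F (QQ N T)) :
    ∫ q in QQ N T, F q = ∫ t in Ioo 0 T, sliceInt F t := by
  rw [IntegrableOn, volume_restrict_QQ] at hF
  rw [volume_restrict_QQ, integral_prod_symm _ hF]
  rfl

lemma PerSupp.integrableOn (hg : PerSupp T g) : IntegrableOn g (QQ N T) :=
  hg.smooth.continuous.continuousOn.integrableOn_QQ

lemma PerSupp.integral_sliceInt (hg : PerSupp T g) :
    ∫ t, sliceInt g t = ∫ q in QQ N T, g q := by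
  rw [integral_QQ_eq hg.integrableOn, ← integral_Icc_eq_integral_Ioo]
  exact (setIntegral_eq_integral_of_forall_compl_eq_zero fun t ht => hg.sliceInt_supp ht).symm

variable {Ω : Type} [MeasurableSpace Ω] {ν : Measure Ω} [SFinite ν] {κ : Ω → ℝ}
  {v : Ω → RN N × ℝ}

lemma PerSupp.sliceInt_kerInt (hg : PerSupp T g) (hκ : Integrable κ ν) (hv : Measurable v)
    (t : ℝ) : sliceInt (kerInt ν κ v g) t = ∫ a, κ a * sliceInt g (t + (v a).2) ∂ν := by
  obtain ⟨C, -, hC⟩ := hg.exists_bound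
  have hgc := hg.smooth.continuous
  have hi : Integrable (fun b : RN N × Ω => κ b.2 * g ((b.1, t) + v b.2))
      ((volume.restrict (cube N)).prod ν) :=
    (hκ.comp_snd _).mul_bdd (c := C)
      ((hgc.stronglyMeasurable.comp_measurable (by fun_prop)).aestronglyMeasurable)
      (ae_of_all _ fun a => hC _)
  simp only [sliceInt, kerInt, smul_eq_mul]
  rw [integral_integral_swap hi]
  refine integral_congr_ae (ae_of_all _ fun a => ?_)
  simp only [integral_const_mul]
  rw [hg.integral_cube_shift]; rfl

lemma PerSupp.integral_kerInt_le (hg : PerSupp T g) (h0 : ∀ p, 0 ≤ g p) (hκ : Integrable κ ν)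
    (hκ0 : ∀ a, 0 ≤ κ a) (hv : Measurable v) :
    ∫ q in QQ N T, kerInt ν κ v g q ≤ (∫ a, κ a ∂ν) * ∫ q in QQ N T, g q := by
  have hs := hg.integrable_sliceInt
  have hsc := hg.contDiff_sliceInt.continuous
  obtain ⟨C, -, hC⟩ := hg.exists_bound
  have hC' : ∀ t, ‖sliceInt g t‖ ≤ C := fun t => by
    have := norm_setIntegral_le_of_norm_le_const (μ := volume) (s := cube N) (C := C)
      (f := fun x => g (x, t)) (by simp [volume_cube]) fun x _ => hC _
    simpa [measureReal_def, volume_cube, sliceInt] using this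
  have hi : Integrable (fun b : ℝ × Ω => κ b.2 * sliceInt g (b.1 + (v b.2).2))
      ((volume.restrict (Ioo 0 T)).prod ν) :=
    (hκ.comp_snd _).mul_bdd (c := C)
      ((hsc.stronglyMeasurable.comp_measurable (by fun_prop)).aestronglyMeasurable)
      (ae_of_all _ fun a => hC' _)
  rw [integral_QQ_eq (hg.contDiff_kerInt hκ hv).continuous.continuousOn.integrableOn_QQ]
  simp_rw [hg.sliceInt_kerInt hκ hv]
  rw [integral_integral_swap hi, ← integral_mul_const]
  refine integral_mono_of_nonneg (ae_of_all _ fun a => ?_) (hκ.mul_const _)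
    (ae_of_all _ fun a => ?_)
  · exact integral_nonneg fun t => mul_nonneg (hκ0 _) (sliceInt_nonneg h0 _)
  · simp only [integral_const_mul]
    refine mul_le_mul_of_nonneg_left ?_ (hκ0 a)
    rw [← hg.integral_sliceInt, ← integral_add_right_eq_self (sliceInt g) (v a).2]
    exact setIntegral_le_integral (hs.comp_add_right _)
      (ae_of_all _ fun t => sliceInt_nonneg h0 _)

lemma PerSupp.heatAvg_le (hg : PerSupp T g) (h0 : ∀ p, 0 ≤ g p) {δ : ℝ} (hδ : 0 < δ)
    (hδ1 : δ ≤ 1) (x : RN N) (t : ℝ) :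
    heatAvg (δ ^ 2) g (x, t) ≤ gkConst N * (δ ^ N)⁻¹ * sliceInt g (t + δ ^ 2) := by
  obtain ⟨C, -, hC⟩ := hg.exists_bound
  have hgc := hg.smooth.continuous
  have hG : ZPeriodic fun y : RN N => g (x + y, t + δ ^ 2) := by
    intro y z
    dsimp only
    rw [← hg.per (x + y, t + δ ^ 2) z]
    congr 1
    ext <;> simp [add_assoc]
  have hGi : ∫ y in cube N, g (x + y, t + δ ^ 2) = sliceInt g (t + δ ^ 2) :=
    setIntegral_cube_add (hg.periodic (t + δ ^ 2)) x
  have h1 := integral_gk_mul_periodic_le hG (by fun_prop) fun y => h0 _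
  rw [hGi] at h1
  have h2 := Measure.integral_comp_smul (volume : Measure (RN N))
    (fun y => gk (1 / 4) (δ⁻¹ • y) * g (x + y, t + δ ^ 2)) δ
  have h3 : heatAvg (δ ^ 2) g (x, t)
      = ∫ z : RN N, gk (1 / 4) (δ⁻¹ • (δ • z)) * g (x + δ • z, t + δ ^ 2) := by
    simp only [heatAvg, kerInt, Real.sqrt_sq hδ.le, smul_eq_mul, inv_smul_smul₀ hδ.ne']
    rfl
  rw [h3, h2]
  simp only [Module.finrank_fin_fun, smul_eq_mul]
  rw [abs_of_pos (by positivity), mul_comm (gkConst N), mul_assoc]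
  refine mul_le_mul_of_nonneg_left (le_trans ?_ h1) (by positivity)
  refine integral_mono_of_nonneg (ae_of_all _ fun y => mul_nonneg (gk_pos _ _).le (h0 _)) ?_
    (ae_of_all _ fun y => ?_)
  · exact integrable_gk_quarter.mul_bdd (c := C) (by fun_prop) (ae_of_all _ fun y => hC _)
  · refine mul_le_mul_of_nonneg_right (Real.exp_le_exp.2 ?_) (h0 _)
    have : ∑ i, y i ^ 2 ≤ ∑ i, (δ⁻¹ • y) i ^ 2 := by
      refine Finset.sum_le_sum fun i _ => ?_
      have h5 : 1 ≤ δ⁻¹ := (one_le_inv₀ hδ).2 hδ1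
      simp only [Pi.smul_apply, smul_eq_mul, mul_pow]
      nlinarith [sq_nonneg (y i),
        mul_nonneg (sq_nonneg (y i)) (sub_nonneg.2 (one_le_pow₀ h5 (n := 2)))]
    linarith

/-- The first absolute moment of the Gaussian weight. -/
def gkMoment (N : ℕ) : ℝ := ∫ z : RN N, ‖z‖ * gk (1 / 4) z

lemma gkMoment_nonneg (N : ℕ) : 0 ≤ gkMoment N :=
  integral_nonneg fun _ => mul_nonneg (norm_nonneg _) (gk_pos _ _).le

/-- A majorant of the spatial gradient of the heat kernel. -/
def gradKer (a : ℝ × RN N) : ℝ := (1 / 2 * (√a.1)⁻¹) * (‖a.2‖ * gk (1 / 4) a.2)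

lemma gradKer_nonneg (a : ℝ × RN N) : 0 ≤ gradKer a := by
  have := gk_pos (1 / 4) a.2
  unfold gradKer
  positivity

/-- A majorant of the spatial gradient of the Duhamel potential. -/
def duhamelMaj (h : ℝ) (g : RN N × ℝ → ℝ) : RN N × ℝ → ℝ :=
  kerInt ((volume.restrict (Ioc 0 h)).prod (volume : Measure (RN N))) gradKer
    (fun a => (√a.1 • a.2, a.1)) g

lemma inv_sqrt_eq_rpow {s : ℝ} (hs : 0 ≤ s) : (√s)⁻¹ = s ^ (-(1 / 2) : ℝ) := by
  rw [Real.sqrt_eq_rpow, Real.rpow_neg hs]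

lemma integrableOn_inv_sqrt {h : ℝ} (hh : 0 ≤ h) :
    IntegrableOn (fun s : ℝ => (√s)⁻¹) (Ioc 0 h) := by
  refine IntegrableOn.congr_fun (f := fun s : ℝ => s ^ (-(1 / 2) : ℝ)) ?_
    (fun s hs => (inv_sqrt_eq_rpow hs.1.le).symm) measurableSet_Ioc
  rw [← intervalIntegrable_iff_integrableOn_Ioc_of_le hh]
  exact intervalIntegral.intervalIntegrable_rpow' (by norm_num)

lemma integral_inv_sqrt {h : ℝ} (hh : 0 ≤ h) : ∫ s in Ioc 0 h, (√s)⁻¹ = 2 * √h := by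
  rw [setIntegral_congr_fun (g := fun s : ℝ => s ^ (-(1 / 2) : ℝ)) measurableSet_Ioc
    (fun s hs => inv_sqrt_eq_rpow hs.1.le), ← intervalIntegral.integral_of_le hh,
    integral_rpow (Or.inl (by norm_num)), Real.sqrt_eq_rpow]
  norm_num
  ring

lemma integrable_gradKer {h : ℝ} (hh : 0 ≤ h) : Integrable (gradKer (N := N))
    ((volume.restrict (Ioc 0 h)).prod (volume : Measure (RN N))) :=
  ((integrableOn_inv_sqrt hh).const_mul (1 / 2)).mul_prod integrable_norm_mul_gk

lemma integral_gradKer {h : ℝ} (hh : 0 ≤ h) :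
    ∫ a, gradKer (N := N) a ∂((volume.restrict (Ioc 0 h)).prod (volume : Measure (RN N)))
      = gkMoment N * √h := by
  have := integral_prod_mul (μ := volume.restrict (Ioc 0 h)) (ν := (volume : Measure (RN N)))
    (fun s : ℝ => 1 / 2 * (√s)⁻¹) (fun z : RN N => ‖z‖ * gk (1 / 4) z)
  simp only [gradKer]
  rw [this, integral_const_mul, integral_inv_sqrt hh, gkMoment]
  ring

lemma duhamelMaj_nonneg (h : ℝ) (h0 : ∀ p, 0 ≤ g p) (p : RN N × ℝ) : 0 ≤ duhamelMaj h g p :=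
  integral_nonneg fun _ => mul_nonneg (gradKer_nonneg _) (h0 _)

lemma PerSupp.continuous_duhamelMaj (hg : PerSupp T g) {h : ℝ} (hh : 0 ≤ h) :
    Continuous (duhamelMaj h g) :=
  (hg.contDiff_kerInt (integrable_gradKer hh) measurable_shift_prod).continuous

lemma PerSupp.duhamelMaj_le (hg : PerSupp T g) (h1 : ∀ p, g p ≤ 1) {h : ℝ}
    (hh : 0 ≤ h) (p : RN N × ℝ) : duhamelMaj h g p ≤ gkMoment N * √h := by
  rw [← integral_gradKer hh]
  exact integral_mono (hg.integrable_kerInt (integrable_gradKer hh) measurable_shift_prod p)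
    (integrable_gradKer hh) fun a => mul_le_of_le_one_right (gradKer_nonneg _) (h1 _)

lemma PerSupp.integral_duhamelMaj_le (hg : PerSupp T g) (h0 : ∀ p, 0 ≤ g p) {h : ℝ}
    (hh : 0 ≤ h) : ∫ q in QQ N T, duhamelMaj h g q ≤ gkMoment N * √h * ∫ q in QQ N T, g q := by
  rw [← integral_gradKer hh]
  exact hg.integral_kerInt_le h0 (integrable_gradKer hh) gradKer_nonneg measurable_shift_prod

lemma PerSupp.abs_heatAvg_fderiv_le (hg : PerSupp T g) (h0 : ∀ p, 0 ≤ g p) {s : ℝ} (hs : 0 < s)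
    (p : RN N × ℝ) (i : Fin N) :
    |heatAvg s (fun q => _root_.fderiv ℝ g q (spaceDir i)) p|
      ≤ ∫ z : RN N, gradKer (s, z) * g (p + (√s • z, s)) := by
  have hs2 : 0 < √s := Real.sqrt_pos.2 hs
  have e : heatAvg s (fun q => _root_.fderiv ℝ g q (spaceDir i)) p
      = 1 / 2 * (√s)⁻¹ * ∫ z : RN N, z i * gk (1 / 4) z * g (p + (√s • z, s)) := by
    rw [hg.integral_coord_mul_slice]
    field_simp
  have hi : Integrable fun z : RN N => ‖z‖ * gk (1 / 4) z * g (p + (√s • z, s)) :=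
    hg.integrable_kerInt integrable_norm_mul_gk (measurable_shift s) p
  simp only [gradKer, mul_assoc (1 / 2 * (√s)⁻¹), integral_const_mul]
  rw [e, abs_mul, abs_of_pos (by positivity : 0 < 1 / 2 * (√s)⁻¹)]
  refine mul_le_mul_of_nonneg_left ?_ (by positivity)
  refine abs_integral_le_integral_abs.trans (integral_mono_of_nonneg
    (ae_of_all _ fun _ => abs_nonneg _) hi (ae_of_all _ fun z => ?_))
  simp only [abs_mul, abs_of_pos (gk_pos (1 / 4) z), abs_of_nonneg (h0 (p + (√s • z, s)))]
  have := gk_pos (1 / 4) z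
  have := h0 (p + (√s • z, s))
  have := norm_le_pi_norm z i
  rw [Real.norm_eq_abs] at this
  gcongr

lemma PerSupp.abs_fderiv_duhamel_le (hg : PerSupp T g) (h0 : ∀ p, 0 ≤ g p) {h : ℝ}
    (hh : 0 ≤ h) (p : RN N × ℝ) (i : Fin N) :
    |_root_.fderiv ℝ (duhamel h g) p (spaceDir i)| ≤ duhamelMaj h g p := by
  have hi := hg.integrable_kerInt (integrable_gradKer (N := N) hh) measurable_shift_prod p
  rw [hg.fderiv_duhamel, (hg.fderiv_apply _).duhamel_eq hh, duhamelMaj, kerInt,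
    integral_prod _ hi, intervalIntegral.integral_of_le hh]
  refine abs_integral_le_integral_abs.trans (integral_mono_of_nonneg
    (ae_of_all _ fun _ => abs_nonneg _) hi.integral_prod_left ?_)
  filter_upwards [ae_restrict_mem measurableSet_Ioc] with s hs
  exact hg.abs_heatAvg_fderiv_le h0 hs.1 p i

lemma duhamel_nonneg (h : ℝ) (h0 : ∀ p, 0 ≤ g p) (p : RN N × ℝ) : 0 ≤ duhamel h g p :=
  integral_nonneg fun _ => mul_nonneg (gk_pos _ _).le (h0 _)

lemma PerSupp.integral_duhamel_zero_le (hg : PerSupp T g) (h0 : ∀ p, 0 ≤ g p) (h : ℝ) :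
    ∫ x in cube N, duhamel h g (x, 0) ≤ gkMass N * ∫ q in QQ N T, g q := by
  have e := hg.sliceInt_kerInt (integrable_gk_prod h) measurable_shift_prod 0
  have e2 := integral_prod_mul (μ := volume.restrict (Ioc 0 h)) (ν := (volume : Measure (RN N)))
    (sliceInt g) (gk (1 / 4))
  have e3 : sliceInt (duhamel h g) 0 = (∫ s in Ioc 0 h, sliceInt g s) * gkMass N := by
    rw [duhamel, e, gkMass, ← e2]
    simp only [zero_add, mul_comm]
  change sliceInt (duhamel h g) 0 ≤ _
  rw [e3, mul_comm, ← hg.integral_sliceInt]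
  exact mul_le_mul_of_nonneg_left (setIntegral_le_integral hg.integrable_sliceInt
    (ae_of_all _ fun t => sliceInt_nonneg h0 _)) (gkMass_pos N).le

lemma PerSupp.duhamel_final (hg : PerSupp T g) {h : ℝ} (hh : 0 ≤ h) (x : RN N) :
    duhamel h g (x, T) = 0 := by
  rw [hg.duhamel_eq hh, intervalIntegral.integral_of_le hh]
  refine (setIntegral_congr_fun measurableSet_Ioc fun s hs => ?_).trans
    (integral_zero ℝ ℝ (μ := volume.restrict (Ioc 0 h)))
  refine (integral_congr_ae (ae_of_all _ fun z => ?_)).trans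
    (integral_zero (RN N) ℝ (μ := volume))
  simp only
  rw [hg.supp _ (by simp only [Prod.snd_add, mem_Icc, not_and, not_le]; intro _; linarith [hs.1]),
    smul_zero]

end KernelBounds

section ConstraintSet

variable {N : ℕ} {T α γ' : ℝ} {m₀ : RN N → ℝ} {m : RN N → ℝ → ℝ} {w : RN N → ℝ → RN N}

lemma deriv_slice {Φ : RN N × ℝ → ℝ} (hΦ : Differentiable ℝ Φ) (x : RN N) (t : ℝ) :
    deriv (fun s => Φ (x, s)) t = fderiv ℝ Φ (x, t) (0, 1) := by
  have h1 : HasDerivAt (fun s : ℝ => (x, s)) ((0 : RN N), (1:ℝ)) t :=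
    (hasDerivAt_const t x).prodMk (hasDerivAt_id t)
  exact ((hΦ (x, t)).hasFDerivAt.comp_hasDerivAt t h1).deriv

lemma pd_slice {Φ : RN N × ℝ → ℝ} (hΦ : Differentiable ℝ Φ) (i : Fin N) (x : RN N) (t : ℝ) :
    pd i (fun y => Φ (y, t)) x = fderiv ℝ Φ (x, t) (spaceDir i) := by
  have h1 : HasFDerivAt (fun y : RN N => (y, t))
      ((ContinuousLinearMap.id ℝ (RN N)).prod (0 : RN N →L[ℝ] ℝ)) x :=
    (hasFDerivAt_id x).prodMk (hasFDerivAt_const t x)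
  have h2 : HasFDerivAt (fun y : RN N => Φ (y, t)) _ x := (hΦ (x, t)).hasFDerivAt.comp x h1
  rw [pd, h2.fderiv]
  simp [spaceDir]

lemma lap_slice {Φ : RN N × ℝ → ℝ} (hΦ : ContDiff ℝ ∞ Φ) (x : RN N) (t : ℝ) :
    lap (fun y => Φ (y, t)) x
      = ∑ i, fderiv ℝ (fun q => fderiv ℝ Φ q (spaceDir i)) (x, t) (spaceDir i) := by
  refine Finset.sum_congr rfl fun i _ => ?_
  have h1 : pd i (fun y => Φ (y, t)) = fun y => fderiv ℝ Φ (y, t) (spaceDir i) :=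
    funext fun y => pd_slice (hΦ.differentiable (by simp)) i y t
  have h2 : ContDiff ℝ ∞ fun q => fderiv ℝ Φ q (spaceDir i) :=
    (hΦ.fderiv_right (by simp)).clm_apply contDiff_const
  rw [h1, pd_slice (Φ := fun q => fderiv ℝ Φ q (spaceDir i)) (h2.differentiable (by simp))]

lemma fp_integrand_eq {Φ : RN N × ℝ → ℝ} (hΦ : ContDiff ℝ ∞ Φ) (a : ℝ) (b : RN N) (x : RN N)
    (t : ℝ) : a * deriv (fun s => Φ (x, s)) t + dotp b (grad (fun y => Φ (y, t)) x)
        + a * lap (fun y => Φ (y, t)) x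
      = a * heatOp Φ (x, t) + ∑ i, b i * fderiv ℝ Φ (x, t) (spaceDir i) := by
  have hd := hΦ.differentiable (by simp)
  simp only [deriv_slice hd, lap_slice hΦ, dotp, grad, pd_slice hd, heatOp]
  ring

/-- The weak Fokker–Planck constraint in terms of space-time derivatives. -/
lemma MemK.weak_eq (hK : MemK N T α γ' m₀ m w) {Φ : RN N × ℝ → ℝ} (hΦ : ContDiff ℝ ∞ Φ)
    (hper : ∀ t, ZPeriodic fun x => Φ (x, t)) (hT : ∀ x, Φ (x, T) = 0) :
    (∫ q in QQ N T, (m q.1 q.2 * heatOp Φ q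
        + ∑ i, w q.1 q.2 i * fderiv ℝ Φ q (spaceDir i)))
      + ∫ x in cube N, m₀ x * Φ (x, 0) = 0 := by
  have h := hK.fp (fun x t => Φ (x, t)) ⟨hΦ, hper⟩ hT
  simpa only [intQ, fp_integrand_eq hΦ, Prod.mk.eta] using h

lemma MemK.aestronglyMeasurable (hα : 0 < α) (hK : MemK N T α γ' m₀ m w) :
    AEStronglyMeasurable (fun q : RN N × ℝ => m q.1 q.2) (volume.restrict (QQ N T)) := by
  have h := (hK.lp_m.aestronglyMeasurable.aemeasurable.pow_const (α + 1)⁻¹).aestronglyMeasurable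
  refine h.congr (ae_of_all _ fun q => ?_)
  exact Real.rpow_rpow_inv (hK.nonneg _ _) (by linarith)

lemma le_rpow_add_one {x p : ℝ} (hx : 0 ≤ x) (hp : 1 ≤ p) : x ≤ x ^ p + 1 := by
  rcases le_total x 1 with h | h
  · have := Real.rpow_nonneg hx p
    linarith
  · have := Real.rpow_le_rpow_of_exponent_le h hp
    rw [Real.rpow_one] at this
    linarith

lemma MemK.integrableOn (hα : 0 < α) (hK : MemK N T α γ' m₀ m w) :
    IntegrableOn (fun q : RN N × ℝ => m q.1 q.2) (QQ N T) := by
  refine (hK.lp_m.add (integrable_const 1)).mono' (hK.aestronglyMeasurable hα)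
    (ae_of_all _ fun q => ?_)
  rw [Real.norm_of_nonneg (hK.nonneg _ _)]
  exact le_rpow_add_one (hK.nonneg _ _) (by linarith)

/-- The total mass is conserved, tested against functions of time. -/
lemma MemK.integral_mul_time (hT : 0 < T) (hm₀ : (∫ x in cube N, m₀ x) = 1)
    (hK : MemK N T α γ' m₀ m w) {ψ : ℝ → ℝ} (hψ : ContDiff ℝ ∞ ψ) :
    ∫ q in QQ N T, m q.1 q.2 * ψ q.2 = ∫ t in Ioo 0 T, ψ t := by
  set Ψ : ℝ → ℝ := fun t => ∫ s in T..t, ψ s with hΨdef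
  have hΨ' : ∀ t, HasDerivAt Ψ (ψ t) t := fun t =>
    intervalIntegral.integral_hasDerivAt_right (hψ.continuous.intervalIntegrable _ _)
      (hψ.continuous.stronglyMeasurableAtFilter _ _) hψ.continuous.continuousAt
  have hΨ : ContDiff ℝ ∞ Ψ := by
    rw [contDiff_infty_iff_deriv]
    refine ⟨fun t => (hΨ' t).differentiableAt, ?_⟩
    rwa [show deriv Ψ = ψ from funext fun t => (hΨ' t).deriv]
  have hf : ∀ (q e : RN N × ℝ), fderiv ℝ (fun q : RN N × ℝ => Ψ q.2) q e = e.2 * ψ q.2 := by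
    intro q e
    have := (hΨ' q.2).hasFDerivAt.comp q (hasFDerivAt_snd (𝕜 := ℝ) (p := q))
    have h2 : HasFDerivAt (fun q : RN N × ℝ => Ψ q.2) _ q := this
    rw [h2.fderiv]
    simp
  have h := hK.weak_eq (Φ := fun q => Ψ q.2) (hΨ.comp contDiff_snd) (fun t x z => rfl)
    (fun x => by simp [hΨdef])
  simp only [heatOp, hf, spaceDir, zero_mul, mul_zero, Finset.sum_const_zero, add_zero, one_mul,
    fderiv_fun_const, Pi.zero_apply, _root_.zero_apply] at h
  rw [integral_mul_const, hm₀, one_mul, hΨdef] at h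
  simp only at h
  rw [intervalIntegral.integral_symm, intervalIntegral.integral_of_le hT.le,
    integral_Ioc_eq_integral_Ioo] at h
  linarith

lemma MemK.integral_eq (hT : 0 < T) (hm₀ : (∫ x in cube N, m₀ x) = 1)
    (hK : MemK N T α γ' m₀ m w) : ∫ q in QQ N T, m q.1 q.2 = T := by
  have h := hK.integral_mul_time hT hm₀ (ψ := fun _ => 1) contDiff_const
  simpa [measureReal_def, hT.le] using h

lemma MemK.integral_final_eq (hm₀ : (∫ x in cube N, m₀ x) = 1)
    (hK : MemK N T α γ' m₀ m w) : ∫ x in cube N, m x T = 1 := by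
  have h := hK.traceId (fun _ _ => 1) ⟨contDiff_const, fun _ _ _ => rfl⟩
  have hp : ∀ i : Fin N, pd i (fun _ : RN N => (1:ℝ)) = fun _ => 0 := fun i => by
    ext x; simp [pd]
  have hp0 : ∀ i : Fin N, pd i (fun _ : RN N => (0:ℝ)) = fun _ => 0 := fun i => by
    ext x; simp [pd]
  simp only [intQ, deriv_const, mul_zero, dotp, grad, hp, lap, hp0, Finset.sum_const_zero,
    add_zero, integral_zero, mul_one, hm₀] at h
  linarith

/-- The stationary pair `(m₀, ∇m₀)` satisfies the constraint. -/
lemma memK_stationary (hT : 0 < T) (hγ : 0 ≤ γ') (hreg : ContDiff ℝ 2 m₀)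
    (hper : ZPeriodic m₀) (hpos : ∀ x, 0 < m₀ x) :
    MemK N T α γ' m₀ (fun x _ => m₀ x) (fun x _ => grad m₀ x) := by
  have hdm : ContDiff ℝ 1 (fderiv ℝ m₀) := hreg.fderiv_right (by norm_num)
  have hpd : ∀ i, ContDiff ℝ 1 (pd i m₀) := fun i => hdm.clm_apply contDiff_const
  have hgc : Continuous (grad m₀) := continuous_pi fun i => (hpd i).continuous
  have hmc := hreg.continuous
  have hpdper : ∀ i, ZPeriodic (pd i m₀) := by
    intro i x z
    have : (fun y : RN N => m₀ (y + fun i => (z i : ℝ))) = m₀ := funext fun y => hper y z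
    simp only [pd]
    conv_rhs => rw [← this]
    rw [fderiv_comp_add_right]
    rfl
  have key : ∀ φ : RN N → ℝ → ℝ, IsTest N φ →
      intQ N T (fun x t => m₀ x * deriv (φ x) t + dotp (grad m₀ x) (grad (fun y => φ y t) x)
        + m₀ x * lap (fun y => φ y t) x)
      + (∫ x in cube N, m₀ x * φ x 0) - (∫ x in cube N, m₀ x * φ x T) = 0 := by
    intro φ hφ
    obtain ⟨hs, hp⟩ := hφ
    set Φ : RN N × ℝ → ℝ := fun q => φ q.1 q.2 with hΦ
    have hs' : ContDiff ℝ ∞ Φ := hs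
    have hdΦ : Continuous fun q => fderiv ℝ Φ q (0, 1) :=
      (hs'.continuous_fderiv (by simp)).clm_apply continuous_const
    have hsl : ∀ t, ContDiff ℝ ∞ fun y => φ y t := fun t =>
      hs'.comp (contDiff_id.prodMk contDiff_const)
    have hslpd : ∀ t i, ContDiff ℝ ∞ (pd i fun y => φ y t) := fun t i =>
      ((hsl t).fderiv_right (by simp)).clm_apply contDiff_const
    have hpp : ∀ t i, ZPeriodic (pd i fun y => φ y t) := by
      intro t i x z
      have : (fun y : RN N => φ (y + fun i => (z i : ℝ)) t) = fun y => φ y t :=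
        funext fun y => hp t y z
      simp only [pd]
      conv_rhs => rw [← this]
      rw [fderiv_comp_add_right (f := fun y => φ y t)]
      rfl
    have hdiv : ∀ t, ∫ x in cube N, (dotp (grad m₀ x) (grad (fun y => φ y t) x)
        + m₀ x * lap (fun y => φ y t) x) = 0 := by
      intro t
      have e : ∀ x, dotp (grad m₀ x) (grad (fun y => φ y t) x) + m₀ x * lap (fun y => φ y t) x
          = ∑ i, pd i (fun y => m₀ y * pd i (fun y => φ y t) y) x := by
        intro x
        rw [dotp, lap, Finset.mul_sum, ← Finset.sum_add_distrib]
        refine Finset.sum_congr rfl fun i _ => ?_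
        have h1 := ((hreg.differentiable (by simp)) x).hasFDerivAt
        have h2 := (((hslpd t i).differentiable (by simp)) x).hasFDerivAt
        have h3 : HasFDerivAt (fun y => m₀ y * pd i (fun y => φ y t) y) _ x := h1.mul h2
        rw [pd, pd, h3.fderiv]
        simp [grad, pd]
        ring
      simp_rw [e]
      have hc1 : ∀ i, ContDiff ℝ 1 fun y => m₀ y * pd i (fun y => φ y t) y := fun i =>
        (hreg.of_le (by norm_num)).mul ((hslpd t i).of_le (by simp))
      rw [integral_finsetSum]
      · refine Finset.sum_eq_zero fun i _ => integral_cube_fderiv_eq_zero ?_ (hc1 i) i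
        intro x z
        simp only
        rw [hper x z, hpp t i x z]
      · intro i _
        have : Continuous (pd i fun y => m₀ y * pd i (fun y => φ y t) y) :=
          ((hc1 i).continuous_fderiv one_ne_zero).clm_apply continuous_const
        exact this.continuousOn.integrableOn_compact (isCompact_cube N)
    have hcont : Continuous fun q : RN N × ℝ => m₀ q.1 * heatOp Φ q
        + ∑ i, grad m₀ q.1 i * fderiv ℝ Φ q (spaceDir i) := by
      have h1 : ∀ e, ContDiff ℝ ∞ fun q => fderiv ℝ Φ q e := fun e =>
        (hs'.fderiv_right (by simp)).clm_apply contDiff_const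
      have h2 : ∀ e, Continuous fun q => fderiv ℝ Φ q e := fun e => (h1 e).continuous
      have h3 : ∀ e, Continuous fun q => fderiv ℝ (fun q => fderiv ℝ Φ q e) q e := fun e =>
        ((h1 e).continuous_fderiv (by simp)).clm_apply continuous_const
      unfold heatOp
      refine ((hmc.comp continuous_fst).mul ((h2 _).add
        (continuous_finsetSum _ fun i _ => h3 _))).add (continuous_finsetSum _ fun i _ => ?_)
      exact (((continuous_apply i).comp hgc).comp continuous_fst).mul (h2 _)
    have e1 : intQ N T (fun x t => m₀ x * deriv (φ x) t
        + dotp (grad m₀ x) (grad (fun y => φ y t) x) + m₀ x * lap (fun y => φ y t) x)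
        = ∫ t in Ioo 0 T, ∫ x in cube N, m₀ x * fderiv ℝ Φ (x, t) (0, 1) := by
      have e0 : ∀ q : RN N × ℝ, m₀ q.1 * deriv (φ q.1) q.2
          + dotp (grad m₀ q.1) (grad (fun y => φ y q.2) q.1) + m₀ q.1 * lap (fun y => φ y q.2) q.1
          = m₀ q.1 * heatOp Φ q + ∑ i, grad m₀ q.1 i * fderiv ℝ Φ q (spaceDir i) :=
        fun q => fp_integrand_eq hs' _ _ _ _
      rw [intQ]
      simp_rw [e0]
      rw [integral_QQ_eq hcont.continuousOn.integrableOn_QQ]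
      refine integral_congr_ae (ae_of_all _ fun t => ?_)
      simp only [sliceInt]
      have e2 : ∀ x, m₀ x * heatOp Φ (x, t)
            + ∑ i, grad m₀ x i * fderiv ℝ Φ (x, t) (spaceDir i)
          = m₀ x * fderiv ℝ Φ (x, t) (0, 1) + (dotp (grad m₀ x) (grad (fun y => φ y t) x)
            + m₀ x * lap (fun y => φ y t) x) := by
        intro x
        rw [← e0 (x, t), ← deriv_slice (hs'.differentiable (by simp))]
        ring
      have hi1 : IntegrableOn (fun x => m₀ x * fderiv ℝ Φ (x, t) (0, 1)) (cube N) := by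
        have : Continuous fun x => m₀ x * fderiv ℝ Φ (x, t) (0, 1) :=
          hmc.mul (hdΦ.comp (by fun_prop))
        exact this.continuousOn.integrableOn_compact (isCompact_cube N)
      have hi2 : IntegrableOn (fun x => m₀ x * heatOp Φ (x, t)
            + ∑ i, grad m₀ x i * fderiv ℝ Φ (x, t) (spaceDir i)) (cube N) := by
        have : Continuous fun x => m₀ x * heatOp Φ (x, t)
            + ∑ i, grad m₀ x i * fderiv ℝ Φ (x, t) (spaceDir i) :=
          hcont.comp (g := fun q : RN N × ℝ => m₀ q.1 * heatOp Φ q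
            + ∑ i, grad m₀ q.1 i * fderiv ℝ Φ q (spaceDir i)) (by fun_prop : Continuous
              fun x : RN N => (x, t))
        exact this.continuousOn.integrableOn_compact (isCompact_cube N)
      have hi3 : IntegrableOn (fun x => dotp (grad m₀ x) (grad (fun y => φ y t) x)
            + m₀ x * lap (fun y => φ y t) x) (cube N) := by
        refine (hi2.sub hi1).congr (ae_of_all _ fun x => ?_)
        simp only [Pi.sub_apply, e2 x]
        ring
      simp_rw [e2]
      rw [integral_add hi1 hi3, hdiv, add_zero]
    have hci : Integrable (fun b : ℝ × RN N => m₀ b.2 * fderiv ℝ Φ (b.2, b.1) (0, 1))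
        ((volume.restrict (Ioo 0 T)).prod (volume.restrict (cube N))) := by
      have : Continuous fun b : ℝ × RN N => m₀ b.2 * fderiv ℝ Φ (b.2, b.1) (0, 1) :=
        (hmc.comp continuous_snd).mul (hdΦ.comp (by fun_prop))
      rw [Measure.prod_restrict, ← Measure.volume_eq_prod]
      exact (this.continuousOn.integrableOn_compact
        (isCompact_Icc.prod (isCompact_cube N))).mono_set
        (Set.prod_mono Ioo_subset_Icc_self subset_rfl)
    rw [e1, integral_integral_swap hci]
    have e3 : ∀ x, ∫ t in Ioo 0 T, m₀ x * fderiv ℝ Φ (x, t) (0, 1)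
        = m₀ x * φ x T - m₀ x * φ x 0 := by
      intro x
      have hd : ∀ t, HasDerivAt (fun s => φ x s) (fderiv ℝ Φ (x, t) (0, 1)) t := by
        intro t
        have h1 : HasDerivAt (fun s : ℝ => (x, s)) ((0 : RN N), (1:ℝ)) t :=
          (hasDerivAt_const t x).prodMk (hasDerivAt_id t)
        exact ((hs'.differentiable (by simp)) (x, t)).hasFDerivAt.comp_hasDerivAt t h1
      rw [integral_const_mul, ← integral_Ioc_eq_integral_Ioo,
        ← intervalIntegral.integral_of_le hT.le,
        intervalIntegral.integral_eq_sub_of_hasDerivAt (fun t _ => hd t)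
          ((hdΦ.comp (by fun_prop)).intervalIntegrable _ _)]
      ring
    have hii : ∀ t, IntegrableOn (fun x => m₀ x * φ x t) (cube N) := fun t =>
      (hmc.mul (hsl t).continuous).continuousOn.integrableOn_compact (isCompact_cube N)
    simp_rw [e3]
    rw [integral_sub (hii T) (hii 0)]
    ring
  refine ⟨fun _ => hper, fun _ x z => ?_, fun x _ => (hpos x).le, ?_, ?_, ?_, ?_, ?_, ?_, key⟩
  · exact funext fun i => hpdper i x z
  · have : Continuous fun q : RN N × ℝ => m₀ q.1 ^ (α + 1) :=
      (hmc.comp continuous_fst).rpow_const fun q => Or.inl (hpos q.1).ne'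
    exact this.continuousOn.integrableOn_QQ
  · have : Continuous fun q : RN N × ℝ => grad m₀ q.1 := hgc.comp continuous_fst
    exact (this.continuousOn.integrableOn_compact ((isCompact_cube N).prod isCompact_Icc)).mono_set
      (Set.prod_mono subset_rfl Ioo_subset_Icc_self)
  · exact ae_of_all _ fun q h => absurd h (hpos q.1).ne'
  · have : Continuous fun q : RN N × ℝ => euclNorm (grad m₀ q.1) ^ γ' * m₀ q.1 ^ (1 - γ') := by
      refine Continuous.mul (Continuous.rpow_const ?_ fun _ => Or.inr hγ)
        ((hmc.comp continuous_fst).rpow_const fun q => Or.inl (hpos q.1).ne')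
      unfold euclNorm
      have : ∀ i, Continuous fun q : RN N × ℝ => grad m₀ q.1 i := fun i =>
        ((continuous_apply i).comp hgc).comp continuous_fst
      fun_prop
    simp only [kinQ, hpos, if_true]
    exact this.continuousOn.integrableOn_QQ
  · exact hmc.continuousOn.integrableOn_compact (isCompact_cube N)
  · intro φ hφ h0
    simpa [h0] using key φ hφ

end ConstraintSet

section Duality

variable {N : ℕ} {T α γ γ' : ℝ} {m₀ : RN N → ℝ} {m : RN N → ℝ → ℝ} {w : RN N → ℝ → RN N}
  {g : RN N × ℝ → ℝ}

lemma euclNorm_nonneg (p : RN N) : 0 ≤ euclNorm p := Real.sqrt_nonneg _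

lemma abs_le_euclNorm (p : RN N) (i : Fin N) : |p i| ≤ euclNorm p := by
  rw [← Real.sqrt_sq_eq_abs]
  exact Real.sqrt_le_sqrt
    (Finset.single_le_sum (f := fun i => p i ^ 2) (fun i _ => sq_nonneg _) (Finset.mem_univ i))

lemma kinQ_nonneg {a : ℝ} (b : RN N) : 0 ≤ kinQ γ' a b := by
  unfold kinQ
  split_ifs with h
  · exact mul_nonneg (Real.rpow_nonneg (euclNorm_nonneg _) _) (Real.rpow_nonneg h.le _)
  · exact le_rfl

/-- Young's inequality splitting `|w| D` into kinetic energy, density and a power of `D`. -/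
lemma euclNorm_mul_le (hγ : 1 < γ) (hγ' : γ' = γ / (γ - 1)) (hα : 0 < α) {a : ℝ} {b : RN N}
    (ha : 0 ≤ a) (hab : a = 0 → b = 0) {D τ : ℝ} (hD : 0 ≤ D) (hτ : 0 < τ) :
    euclNorm b * D ≤ τ * (kinQ γ' a b + a ^ (α + 1))
      + τ ^ (1 - γ * (α + 1) / α) * D ^ (γ * (α + 1) / α) := by
  have hg0 : 0 < γ - 1 := by linarith
  set q := γ * (α + 1) / α with hq
  have hq0 : 0 < q := by positivity
  have hk := kinQ_nonneg (γ' := γ') (a := a) b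
  have hap : 0 ≤ a ^ (α + 1) := Real.rpow_nonneg ha _
  have hr : 0 ≤ τ ^ (1 - q) * D ^ q := by positivity
  rcases ha.eq_or_lt with h0 | h0
  · rw [hab h0.symm]
    simp only [euclNorm, Pi.zero_apply, ne_eq, OfNat.ofNat_ne_zero, not_false_eq_true, zero_pow,
      Finset.sum_const_zero, Real.sqrt_zero, zero_mul]
    rw [hab h0.symm] at hk
    positivity
  have hw := euclNorm_nonneg b
  have hγ0 : γ' ≠ 0 := by rw [hγ']; positivity
  have e : euclNorm b * D = (τ * kinQ γ' a b) ^ (1 / γ')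
      * (τ * a ^ (α + 1)) ^ (1 / (γ * (α + 1))) * (τ ^ (1 - q) * D ^ q) ^ (1 / q) := by
    simp only [kinQ, h0, if_true]
    rw [Real.mul_rpow hτ.le (by positivity), Real.mul_rpow (by positivity) (by positivity),
      Real.mul_rpow hτ.le hap, Real.mul_rpow (by positivity) (by positivity),
      ← Real.rpow_mul hw, ← Real.rpow_mul ha, ← Real.rpow_mul ha, ← Real.rpow_mul hτ.le,
      ← Real.rpow_mul hD, mul_one_div_cancel hγ0, mul_one_div_cancel hq0.ne', Real.rpow_one,
      Real.rpow_one]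
    have e1 : a ^ ((1 - γ') * (1 / γ')) * a ^ ((α + 1) * (1 / (γ * (α + 1)))) = 1 := by
      rw [← Real.rpow_add h0]
      have : (1 - γ') * (1 / γ') + (α + 1) * (1 / (γ * (α + 1))) = 0 := by
        rw [hγ']; field_simp; ring
      rw [this, Real.rpow_zero]
    have e2 : τ ^ (1 / γ') * τ ^ (1 / (γ * (α + 1))) * τ ^ ((1 - q) * (1 / q)) = 1 := by
      rw [← Real.rpow_add hτ, ← Real.rpow_add hτ]
      have : 1 / γ' + 1 / (γ * (α + 1)) + (1 - q) * (1 / q) = 0 := by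
        rw [hγ', hq]; field_simp; ring
      rw [this, Real.rpow_zero]
    calc euclNorm b * D
        = euclNorm b * D * (a ^ ((1 - γ') * (1 / γ')) * a ^ ((α + 1) * (1 / (γ * (α + 1)))))
          * (τ ^ (1 / γ') * τ ^ (1 / (γ * (α + 1))) * τ ^ ((1 - q) * (1 / q))) := by
          rw [e1, e2, mul_one, mul_one]
      _ = _ := by ring
  have h1 : 0 ≤ 1 / γ' := by rw [hγ']; positivity
  have h2 : 0 ≤ 1 / (γ * (α + 1)) := by positivity
  have h3 : 0 ≤ 1 / q := by positivity
  have hs : 1 / γ' + 1 / (γ * (α + 1)) + 1 / q = 1 := by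
    rw [hγ', hq]; field_simp; ring
  rw [e]
  refine (Real.geom_mean_le_arith_mean3_weighted h1 h2 h3 (by positivity) (by positivity) hr
    hs).trans ?_
  have i1 : 1 / γ' * (τ * kinQ γ' a b) ≤ τ * kinQ γ' a b :=
    mul_le_of_le_one_left (by positivity) (by linarith)
  have i2 : 1 / (γ * (α + 1)) * (τ * a ^ (α + 1)) ≤ τ * a ^ (α + 1) :=
    mul_le_of_le_one_left (by positivity) (by linarith)
  have i3 : 1 / q * (τ ^ (1 - q) * D ^ q) ≤ τ ^ (1 - q) * D ^ q :=
    mul_le_of_le_one_left (by positivity) (by linarith)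
  linarith

lemma MeasureTheory.IntegrableOn.mul_continuous_QQ {F G : RN N × ℝ → ℝ}
    (hF : IntegrableOn F (QQ N T))
    (hG : Continuous G) : IntegrableOn (fun q => F q * G q) (QQ N T) := by
  obtain ⟨C, hC⟩ := ((isCompact_cube N).prod (isCompact_Icc (a := 0) (b := T))
    ).exists_bound_of_continuousOn hG.continuousOn
  refine Integrable.mul_bdd (c := C) hF hG.aestronglyMeasurable ?_
  filter_upwards [ae_restrict_mem (measurableSet_QQ N T)] with q hq
  exact hC q ⟨hq.1, Ioo_subset_Icc_self hq.2⟩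

lemma MemK.integrable_w (hK : MemK N T α γ' m₀ m w) (i : Fin N) :
    IntegrableOn (fun q : RN N × ℝ => w q.1 q.2 i) (QQ N T) :=
  (ContinuousLinearMap.proj (R := ℝ) (φ := fun _ : Fin N => ℝ) i).integrable_comp hK.l1_w

/-- The duality estimate: the constraint tested with a Duhamel potential. -/
lemma MemK.integral_mul_le (hT : 0 < T) (hγ : 1 < γ) (hγ' : γ' = γ / (γ - 1)) (hα : 0 < α)
    (hm₀ : (∫ x in cube N, m₀ x) = 1) (hm₀c : Continuous m₀) {M₀ : ℝ} (hM₀ : ∀ x, m₀ x ≤ M₀)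
    (hM₀0 : 0 ≤ M₀)
    (hK : MemK N T α γ' m₀ m w) (hg : PerSupp T g) (h0 : ∀ p, 0 ≤ g p) (h1 : ∀ p, g p ≤ 1)
    {δ τ : ℝ} (hδ : 0 < δ) (hδ1 : δ ≤ 1) (hτ : 0 < τ) :
    gkMass N * ∫ q in QQ N T, m q.1 q.2 * g q
      ≤ (gkConst N * (δ ^ N)⁻¹ + M₀ * gkMass N
          + N * τ ^ (1 - γ * (α + 1) / α) * (gkMoment N * δ) ^ (γ * (α + 1) / α))
          * (∫ q in QQ N T, g q)
        + N * τ * ((∫ q in QQ N T, kinQ γ' (m q.1 q.2) (w q.1 q.2))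
          + ∫ q in QQ N T, m q.1 q.2 ^ (α + 1)) := by
  set r := γ * (α + 1) / α with hr
  have hr1 : 1 < r := by
    rw [hr, lt_div_iff₀ hα]; nlinarith
  have hh : (0:ℝ) ≤ δ ^ 2 := sq_nonneg δ
  have hsq : √(δ ^ 2) = δ := Real.sqrt_sq hδ.le
  set Φ := duhamel (δ ^ 2) g with hΦ
  set D := duhamelMaj (δ ^ 2) g with hD
  have hΦs : ContDiff ℝ ∞ Φ := hg.contDiff_duhamel _
  have hD0 : ∀ q, 0 ≤ D q := duhamelMaj_nonneg _ h0
  have hDM : ∀ q, D q ≤ gkMoment N * δ := fun q => by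
    have := hg.duhamelMaj_le h1 hh q
    rwa [hsq] at this
  have hDi : IntegrableOn D (QQ N T) :=
    (hg.continuous_duhamelMaj hh).continuousOn.integrableOn_QQ
  have hDint : ∫ q in QQ N T, D q ≤ gkMoment N * δ * ∫ q in QQ N T, g q := by
    have := hg.integral_duhamelMaj_le h0 hh
    rwa [hsq] at this
  have hsl := hg.contDiff_sliceInt
  have hcd : ∀ e, ContDiff ℝ ∞ fun q => fderiv ℝ Φ q e := fun e =>
    (hΦs.fderiv_right (by simp)).clm_apply contDiff_const
  have hheat : Continuous (heatOp Φ) := by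
    unfold heatOp
    refine (hcd _).continuous.add (continuous_finsetSum _ fun i _ => ?_)
    exact ((hcd _).continuous_fderiv (by simp)).clm_apply continuous_const
  have hmi := hK.integrableOn hα
  have hIi : IntegrableOn (fun q => m q.1 q.2 * heatOp Φ q
      + ∑ i, w q.1 q.2 i * fderiv ℝ Φ q (spaceDir i)) (QQ N T) :=
    (hmi.mul_continuous_QQ hheat).add (integrable_finsetSum _ fun i _ =>
      (hK.integrable_w i).mul_continuous_QQ (hcd _).continuous)
  have hmg : IntegrableOn (fun q => m q.1 q.2 * g q) (QQ N T) :=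
    hmi.mul_continuous_QQ hg.smooth.continuous
  have hms : IntegrableOn (fun q => m q.1 q.2 * sliceInt g (q.2 + δ ^ 2)) (QQ N T) :=
    hmi.mul_continuous_QQ (hsl.continuous.comp (by fun_prop))
  have hkX : IntegrableOn (fun q : RN N × ℝ => kinQ γ' (m q.1 q.2) (w q.1 q.2)
      + m q.1 q.2 ^ (α + 1)) (QQ N T) := hK.kin_int.add hK.lp_m
  have hweak := hK.weak_eq hΦs (fun t => hg.kerInt_periodic t) (fun x => hg.duhamel_final hh x)
  have hpt : ∀ᵐ q ∂(volume.restrict (QQ N T)), gkMass N * (m q.1 q.2 * g q)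
      ≤ gkConst N * (δ ^ N)⁻¹ * (m q.1 q.2 * sliceInt g (q.2 + δ ^ 2))
        + (N * τ * (kinQ γ' (m q.1 q.2) (w q.1 q.2) + m q.1 q.2 ^ (α + 1))
          + N * τ ^ (1 - r) * (gkMoment N * δ) ^ (r - 1) * D q)
        - (m q.1 q.2 * heatOp Φ q + ∑ i, w q.1 q.2 i * fderiv ℝ Φ q (spaceDir i)) := by
    filter_upwards [hK.vanish] with q hq
    have hm := hK.nonneg q.1 q.2
    have a1 : heatAvg (δ ^ 2) g q ≤ gkConst N * (δ ^ N)⁻¹ * sliceInt g (q.2 + δ ^ 2) :=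
      hg.heatAvg_le h0 hδ hδ1 q.1 q.2
    have a2 := euclNorm_mul_le hγ hγ' hα hm hq (hD0 q) hτ
    have a3 : D q ^ r ≤ (gkMoment N * δ) ^ (r - 1) * D q := by
      have : D q ^ r = D q ^ (r - 1) * D q := by
        rw [← Real.rpow_add_one' (hD0 q) (by linarith)]; ring_nf
      rw [this]
      exact mul_le_mul_of_nonneg_right
        (Real.rpow_le_rpow (hD0 q) (hDM q) (by linarith)) (hD0 q)
    have a4 : ∑ i, w q.1 q.2 i * fderiv ℝ Φ q (spaceDir i)
        ≤ N * (euclNorm (w q.1 q.2) * D q) := by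
      have : ∀ i ∈ Finset.univ, w q.1 q.2 i * fderiv ℝ Φ q (spaceDir i)
          ≤ euclNorm (w q.1 q.2) * D q := fun i _ => by
        refine (le_abs_self _).trans ?_
        rw [abs_mul]
        exact mul_le_mul (abs_le_euclNorm _ i) (hg.abs_fderiv_duhamel_le h0 hh q i)
          (abs_nonneg _) (euclNorm_nonneg _)
      simpa using Finset.sum_le_sum this
    have a5 : τ ^ (1 - r) * D q ^ r ≤ τ ^ (1 - r) * ((gkMoment N * δ) ^ (r - 1) * D q) :=
      mul_le_mul_of_nonneg_left a3 (by positivity)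
    have a6 : (N : ℝ) * (euclNorm (w q.1 q.2) * D q)
        ≤ N * (τ * (kinQ γ' (m q.1 q.2) (w q.1 q.2) + m q.1 q.2 ^ (α + 1))
          + τ ^ (1 - r) * ((gkMoment N * δ) ^ (r - 1) * D q)) :=
      mul_le_mul_of_nonneg_left (a2.trans (by linarith)) (Nat.cast_nonneg N)
    have a7 := mul_le_mul_of_nonneg_left a1 hm
    rw [hg.heatOp_duhamel hh]
    nlinarith
  have hA := hms.const_mul (gkConst N * (δ ^ N)⁻¹)
  have hB := hkX.const_mul (N * τ)
  have hC := hDi.const_mul (N * τ ^ (1 - r) * (gkMoment N * δ) ^ (r - 1))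
  have hBC : IntegrableOn (fun q : RN N × ℝ =>
      N * τ * (kinQ γ' (m q.1 q.2) (w q.1 q.2) + m q.1 q.2 ^ (α + 1))
        + N * τ ^ (1 - r) * (gkMoment N * δ) ^ (r - 1) * D q) (QQ N T) := hB.add hC
  have hABC : IntegrableOn (fun q : RN N × ℝ =>
      gkConst N * (δ ^ N)⁻¹ * (m q.1 q.2 * sliceInt g (q.2 + δ ^ 2))
        + (N * τ * (kinQ γ' (m q.1 q.2) (w q.1 q.2) + m q.1 q.2 ^ (α + 1))
        + N * τ ^ (1 - r) * (gkMoment N * δ) ^ (r - 1) * D q)) (QQ N T) := hA.add hBC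
  have hint := integral_mono_ae (hmg.const_mul (gkMass N)) (hABC.sub hIi) hpt
  rw [integral_const_mul] at hint
  simp only [Pi.sub_apply] at hint
  rw [integral_sub hABC hIi, integral_add hA hBC, integral_add hB hC, integral_const_mul,
    integral_const_mul, integral_const_mul, integral_add hK.kin_int hK.lp_m] at hint
  have hs1 : ∫ q in QQ N T, m q.1 q.2 * sliceInt g (q.2 + δ ^ 2) ≤ ∫ q in QQ N T, g q := by
    rw [hK.integral_mul_time hT hm₀ (ψ := fun t => sliceInt g (t + δ ^ 2))
      (hsl.comp (by fun_prop)), ← hg.integral_sliceInt,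
      ← integral_add_right_eq_self (sliceInt g) (δ ^ 2)]
    exact setIntegral_le_integral (hg.integrable_sliceInt.comp_add_right _)
      (ae_of_all _ fun t => sliceInt_nonneg h0 _)
  have hs2 : ∫ x in cube N, m₀ x * Φ (x, 0) ≤ M₀ * (gkMass N * ∫ q in QQ N T, g q) := by
    have hΦc : Continuous fun x : RN N => Φ (x, 0) := hΦs.continuous.comp (by fun_prop)
    refine le_trans ?_ (mul_le_mul_of_nonneg_left (hg.integral_duhamel_zero_le h0 (δ ^ 2)) hM₀0)
    rw [← integral_const_mul]
    refine integral_mono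
      ((hm₀c.mul hΦc).continuousOn.integrableOn_compact (isCompact_cube N))
      ((hΦc.const_mul M₀).continuousOn.integrableOn_compact (isCompact_cube N)) fun x => ?_
    exact mul_le_mul_of_nonneg_right (hM₀ x) (duhamel_nonneg _ h0 _)
  have hM : (gkMoment N * δ) ^ r = (gkMoment N * δ) ^ (r - 1) * (gkMoment N * δ) := by
    rw [← Real.rpow_add_one' (mul_nonneg (gkMoment_nonneg N) hδ.le) (by linarith)]; ring_nf
  have hMn : 0 ≤ (N : ℝ) * τ ^ (1 - r) * (gkMoment N * δ) ^ (r - 1) :=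
    mul_nonneg (by positivity) (Real.rpow_nonneg (mul_nonneg (gkMoment_nonneg N) hδ.le) _)
  have b1 := mul_le_mul_of_nonneg_left hDint hMn
  have b2 := mul_le_mul_of_nonneg_left hs1
    (mul_nonneg (gkConst_pos N).le (by positivity : 0 ≤ (δ ^ N)⁻¹))
  rw [hM]
  linarith

end Duality

section Mollification

variable {N : ℕ} {T : ℝ}

/-- The periodic extension in space of the indicator of `S`. -/
def perInd (S : Set (RN N × ℝ)) (p : RN N × ℝ) : ℝ :=
  S.indicator (fun _ => 1) (fun i => Int.fract (p.1 i), p.2)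

lemma perInd_nonneg (S : Set (RN N × ℝ)) (p : RN N × ℝ) : 0 ≤ perInd S p :=
  indicator_nonneg (fun _ _ => zero_le_one) _

lemma perInd_le_one (S : Set (RN N × ℝ)) (p : RN N × ℝ) : perInd S p ≤ 1 :=
  indicator_le_self' (fun _ _ => zero_le_one) _

lemma measurable_perInd {S : Set (RN N × ℝ)} (hS : MeasurableSet S) : Measurable (perInd S) := by
  refine (measurable_const.indicator hS).comp (Measurable.prodMk ?_ measurable_snd)
  exact measurable_pi_lambda _ fun i =>
    measurable_fract.comp ((measurable_pi_apply i).comp measurable_fst)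

lemma locallyIntegrable_perInd {S : Set (RN N × ℝ)} (hS : MeasurableSet S) :
    LocallyIntegrable (perInd S) := by
  refine (locallyIntegrable_const (1 : ℝ)).mono (measurable_perInd hS).aestronglyMeasurable
    (ae_of_all _ fun p => ?_)
  rw [Real.norm_of_nonneg (perInd_nonneg S p), norm_one]
  exact perInd_le_one S p

lemma perInd_ae_eq (S : Set (RN N × ℝ)) :
    ∀ᵐ q ∂(volume.restrict (QQ N T)), perInd S q = S.indicator (fun _ => 1) q := by
  have h1 : ∀ᵐ q : RN N × ℝ, ∀ i, q.1 i ≠ 1 := by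
    rw [ae_all_iff]
    intro i
    have h0 : ∀ᵐ x : RN N, x i ≠ 1 := Measure.ae_eval_ne (μ := fun _ => (volume : Measure ℝ)) i 1
    exact (Measure.quasiMeasurePreserving_fst (ν := (volume : Measure ℝ))).ae h0
  filter_upwards [ae_restrict_mem (measurableSet_QQ N T), ae_restrict_of_ae h1] with q hq hq1
  have : ((fun i => Int.fract (q.1 i)), q.2) = q := by
    refine Prod.ext (funext fun i => Int.fract_eq_self.2 ⟨hq.1.1 i, ?_⟩) rfl
    exact lt_of_le_of_ne (hq.1.2 i) (hq1 i)
  rw [perInd, this]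

instance isAddHaarMeasure_volume_prod (N : ℕ) :
    (volume : Measure (RN N × ℝ)).IsAddHaarMeasure :=
  inferInstanceAs ((volume : Measure (RN N)).prod (volume : Measure ℝ)).IsAddHaarMeasure

/-- Indicators of sets away from the initial and final times are limits of smooth periodic
functions. -/
lemma exists_perSupp_tendsto {S : Set (RN N × ℝ)} (hS : MeasurableSet S) {δ : ℝ} (hδ : 0 < δ)
    (hSδ : ∀ p ∈ S, p.2 ∈ Icc δ (T - δ)) :
    ∃ g : ℕ → RN N × ℝ → ℝ, (∀ n, PerSupp T (g n)) ∧ (∀ n p, 0 ≤ g n p) ∧ (∀ n p, g n p ≤ 1) ∧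
      ∀ᵐ q ∂(volume.restrict (QQ N T)),
        Tendsto (fun n => g n q) atTop (𝓝 (S.indicator (fun _ => 1) q)) := by
  let φ : ℕ → ContDiffBump (0 : RN N × ℝ) := fun n =>
    { rIn := δ / (n + 1) / 2
      rOut := δ / (n + 1)
      rIn_pos := by positivity
      rIn_lt_rOut := half_lt_self (by positivity) }
  have hout : ∀ n, (φ n).rOut = δ / (n + 1) := fun n => rfl
  have hout_le : ∀ n, (φ n).rOut ≤ δ := fun n => by
    rw [hout]
    exact div_le_self hδ.le (by simp)
  let g : ℕ → RN N × ℝ → ℝ := fun n p => ∫ y, (φ n).normed volume y * perInd S (p - y)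
  have hg : ∀ n, g n = convolution ((φ n).normed volume) (perInd S)
      (ContinuousLinearMap.lsmul ℝ ℝ) volume := fun n => rfl
  have hint : ∀ n p, Integrable (fun y => (φ n).normed volume y * perInd S (p - y)) := by
    intro n p
    refine (φ n).integrable_normed.mul_bdd (c := 1)
      ((measurable_perInd hS).comp (measurable_const.sub measurable_id)).aestronglyMeasurable
      (ae_of_all _ fun y => ?_)
    rw [Real.norm_of_nonneg (perInd_nonneg S _)]
    exact perInd_le_one S _
  refine ⟨g, fun n => ⟨?_, ?_, ?_⟩, fun n p => ?_, fun n p => ?_, ?_⟩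
  · rw [hg]
    exact (φ n).hasCompactSupport_normed.contDiff_convolution_left _ (φ n).contDiff_normed
      (locallyIntegrable_perInd hS)
  · intro p z
    refine integral_congr_ae (ae_of_all _ fun y => ?_)
    have : ∀ i, Int.fract (p.1 i + (z i : ℝ) - y.1 i) = Int.fract (p.1 i - y.1 i) := fun i => by
      rw [add_sub_right_comm, Int.fract_add_intCast]
    simp [perInd, this]
  · intro p hp
    refine integral_eq_zero_of_ae (ae_of_all _ fun y => ?_)
    by_cases hy : (φ n).normed volume y = 0
    · simp [hy]
    · have hy' : y ∈ Metric.ball (0 : RN N × ℝ) (φ n).rOut := by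
        rw [← (φ n).support_normed_eq (μ := volume)]
        exact hy
      have h2 : |y.2| ≤ δ := by
        rw [mem_ball_zero_iff] at hy'
        exact ((norm_snd_le y).trans hy'.le).trans (hout_le n)
      have : ((fun i => Int.fract ((p - y).1 i)), (p - y).2) ∉ S := fun hmem => hp <| by
        have h3 := hSδ _ hmem
        have h4 := abs_le.1 h2
        simp only [Prod.snd_sub, mem_Icc] at h3
        exact ⟨by linarith, by linarith⟩
      exact mul_eq_zero_of_right _ (indicator_of_notMem this _)
  · exact integral_nonneg fun y => mul_nonneg ((φ n).nonneg_normed y) (perInd_nonneg S _)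
  · rw [← (φ n).integral_normed (μ := volume)]
    exact integral_mono (hint n p) (φ n).integrable_normed fun y =>
      mul_le_of_le_one_right ((φ n).nonneg_normed y) (perInd_le_one S _)
  · have hlim : Tendsto (fun n => (φ n).rOut) atTop (𝓝 0) :=
      tendsto_const_nhds.div_atTop (tendsto_natCast_atTop_atTop.atTop_add tendsto_const_nhds)
    have h := ContDiffBump.ae_convolution_tendsto_right_of_locallyIntegrable (μ := volume)
      (φ := φ) (K := 2) hlim (Eventually.of_forall fun n => by
        change δ / (n + 1) ≤ 2 * (δ / (n + 1) / 2)
        linarith) (locallyIntegrable_perInd hS)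
    filter_upwards [ae_restrict_of_ae h, perInd_ae_eq S] with q hq1 hq2
    rw [← hq2]
    exact hq1

end Mollification

section LevelSets

variable {N : ℕ} {T α γ γ' : ℝ} {m₀ : RN N → ℝ} {m : RN N → ℝ → ℝ} {w : RN N → ℝ → RN N}

/-- Linear inequalities between integrals pass to bounded almost everywhere limits. -/
lemma integral_mul_le_of_tendsto {X : Type*} [MeasurableSpace X] {μ : Measure X}
    [IsFiniteMeasure μ] {u g : X → ℝ} {G : ℕ → X → ℝ} (hu : Integrable u μ)
    (hG : ∀ n, AEStronglyMeasurable (G n) μ) (h0 : ∀ n x, 0 ≤ G n x) (h1 : ∀ n x, G n x ≤ 1)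
    (hlim : ∀ᵐ x ∂μ, Tendsto (fun n => G n x) atTop (𝓝 (g x))) {c A B : ℝ}
    (hle : ∀ n, c * ∫ x, u x * G n x ∂μ ≤ A * (∫ x, G n x ∂μ) + B) :
    c * ∫ x, u x * g x ∂μ ≤ A * (∫ x, g x ∂μ) + B := by
  have hb : ∀ n x, ‖G n x‖ ≤ 1 := fun n x => by
    rw [Real.norm_of_nonneg (h0 n x)]
    exact h1 n x
  have l1 : Tendsto (fun n => ∫ x, u x * G n x ∂μ) atTop (𝓝 (∫ x, u x * g x ∂μ)) :=
    tendsto_integral_of_dominated_convergence (fun x => ‖u x‖)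
      (fun n => hu.aestronglyMeasurable.mul (hG n)) hu.norm
      (fun n => ae_of_all _ fun x => by
        rw [norm_mul]
        exact mul_le_of_le_one_right (norm_nonneg _) (hb n x))
      (hlim.mono fun x hx => hx.const_mul _)
  have l2 : Tendsto (fun n => ∫ x, G n x ∂μ) atTop (𝓝 (∫ x, g x ∂μ)) :=
    tendsto_integral_of_dominated_convergence (fun _ => 1) hG (integrable_const _)
      (fun n => ae_of_all _ (hb n)) hlim
  exact le_of_tendsto_of_tendsto' (l1.const_mul c) ((l2.const_mul A).add_const B) hle

/-- An inequality tested on smooth functions with values in `[0,1]` holds for indicators. -/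
lemma integral_mul_indicator_le {u : RN N × ℝ → ℝ} (hu : IntegrableOn u (QQ N T)) {c A B : ℝ}
    (hle : ∀ g : RN N × ℝ → ℝ, PerSupp T g → (∀ p, 0 ≤ g p) → (∀ p, g p ≤ 1) →
      c * ∫ q in QQ N T, u q * g q ≤ A * (∫ q in QQ N T, g q) + B)
    {S : Set (RN N × ℝ)} (hS : MeasurableSet S) :
    c * ∫ q in QQ N T, u q * S.indicator (fun _ => 1) q
      ≤ A * (∫ q in QQ N T, S.indicator (fun _ => 1) q) + B := by
  let S' : ℕ → Set (RN N × ℝ) := fun n =>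
    S ∩ {p | p.2 ∈ Icc (1 / ((n : ℝ) + 1)) (T - 1 / ((n : ℝ) + 1))}
  have hS' : ∀ n, MeasurableSet (S' n) := fun n => hS.inter (measurable_snd measurableSet_Icc)
  have hind0 : ∀ n (q : RN N × ℝ), 0 ≤ (S' n).indicator (fun _ => (1 : ℝ)) q :=
    fun n q => indicator_nonneg (fun _ _ => zero_le_one) _
  have hind1 : ∀ n (q : RN N × ℝ), (S' n).indicator (fun _ => (1 : ℝ)) q ≤ 1 :=
    fun n q => indicator_le_self' (fun _ _ => zero_le_one) _
  refine integral_mul_le_of_tendsto (G := fun n => (S' n).indicator fun _ => 1) hu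
    (fun n => (measurable_const.indicator (hS' n)).aestronglyMeasurable) hind0 hind1 ?_ ?_
  · filter_upwards [ae_restrict_mem (measurableSet_QQ N T)] with q hq
    have hd : Tendsto (fun n : ℕ => 1 / ((n : ℝ) + 1)) atTop (𝓝 0) :=
      tendsto_one_div_add_atTop_nhds_zero_nat
    have hd' : Tendsto (fun n : ℕ => T - 1 / ((n : ℝ) + 1)) atTop (𝓝 T) := by
      simpa using hd.const_sub T
    refine tendsto_const_nhds.congr' ?_
    filter_upwards [hd.eventually_le_const hq.2.1, hd'.eventually_const_le hq.2.2] with n h1 h2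
    by_cases hqS : q ∈ S
    · rw [indicator_of_mem hqS, indicator_of_mem]
      exact ⟨hqS, h1, h2⟩
    · rw [indicator_of_notMem hqS, indicator_of_notMem]
      exact fun h => hqS h.1
  · intro n
    obtain ⟨g, hg, h0, h1, hlim⟩ := exists_perSupp_tendsto (T := T) (hS' n)
      (show 0 < 1 / ((n : ℝ) + 1) by positivity) fun p hp => hp.2
    exact integral_mul_le_of_tendsto hu
      (fun k => (hg k).smooth.continuous.aestronglyMeasurable) h0 h1 hlim
      fun k => hle _ (hg k) (h0 k) (h1 k)

lemma MemK.level_set_le (hT : 0 < T) (hγ : 1 < γ) (hγ' : γ' = γ / (γ - 1)) (hα : 0 < α)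
    (hm₀ : (∫ x in cube N, m₀ x) = 1) (hm₀c : Continuous m₀) {M₀ : ℝ} (hM₀ : ∀ x, m₀ x ≤ M₀)
    (hM₀0 : 0 ≤ M₀) (hK : MemK N T α γ' m₀ m w) {δ τ : ℝ} (hδ : 0 < δ) (hδ1 : δ ≤ 1)
    (hτ : 0 < τ) (l : ℝ) :
    (gkMass N * l - (gkConst N * (δ ^ N)⁻¹ + M₀ * gkMass N
        + N * τ ^ (1 - γ * (α + 1) / α) * (gkMoment N * δ) ^ (γ * (α + 1) / α)))
      * (volume.restrict (QQ N T)).real {q | l < m q.1 q.2}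
      ≤ N * τ * ((∫ q in QQ N T, kinQ γ' (m q.1 q.2) (w q.1 q.2))
        + ∫ q in QQ N T, m q.1 q.2 ^ (α + 1)) := by
  have hmi := hK.integrableOn hα
  set u := hmi.aestronglyMeasurable.aemeasurable.mk _ with hu
  have hum : Measurable u := hmi.aestronglyMeasurable.aemeasurable.measurable_mk
  have hmu : ∀ᵐ q ∂(volume.restrict (QQ N T)), m q.1 q.2 = u q :=
    hmi.aestronglyMeasurable.aemeasurable.ae_eq_mk
  set S := {q | l < u q} with hSdef
  have hS : MeasurableSet S := measurableSet_lt measurable_const hum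
  have h := integral_mul_indicator_le hmi (fun g hg h0 h1 => hK.integral_mul_le hT hγ hγ' hα hm₀
    hm₀c hM₀ hM₀0 hg h0 h1 hδ hδ1 hτ) hS
  have hSm : (volume.restrict (QQ N T)).real {q | l < m q.1 q.2}
      = ∫ q in QQ N T, S.indicator (fun _ => 1) q := by
    rw [integral_indicator_const _ hS, smul_eq_mul, mul_one]
    refine measureReal_congr ?_
    filter_upwards [hmu] with q hq
    exact congrArg (l < ·) hq
  have hi : IntegrableOn (S.indicator fun _ => (1 : ℝ)) (QQ N T) :=
    (integrable_const 1).indicator hS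
  have hl : l * ∫ q in QQ N T, S.indicator (fun _ => (1 : ℝ)) q
      ≤ ∫ q in QQ N T, m q.1 q.2 * S.indicator (fun _ => 1) q := by
    rw [← integral_const_mul]
    refine integral_mono_ae (hi.const_mul l) ?_ ?_
    · refine hmi.mul_bdd (c := 1) hi.aestronglyMeasurable (ae_of_all _ fun q => ?_)
      rw [Real.norm_of_nonneg (indicator_nonneg (fun _ _ => zero_le_one) _)]
      exact indicator_le_self' (fun _ _ => zero_le_one) _
    · filter_upwards [hmu] with q hq
      by_cases hqS : q ∈ S
      · rw [indicator_of_mem hqS, hq]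
        exact mul_le_mul_of_nonneg_right (le_of_lt hqS) zero_le_one
      · rw [indicator_of_notMem hqS, mul_zero, mul_zero]
  rw [hSm]
  have := mul_le_mul_of_nonneg_left hl (gkMass_pos N).le
  linarith

/-- Decay of the measure of the superlevel sets in the subcritical regime. -/
lemma exists_level_set_decay (hN : 1 ≤ N) (hT : 0 < T) (hγ : 1 < γ) (hγ' : γ' = γ / (γ - 1))
    (hα : 0 < α) (hsub : α < γ' / N) (hm₀ : (∫ x in cube N, m₀ x) = 1) (hm₀c : Continuous m₀)
    {M₀ : ℝ} (hM₀ : ∀ x, m₀ x ≤ M₀) (hM₀0 : 0 ≤ M₀) :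
    ∃ C Λ s : ℝ, 0 ≤ C ∧ 1 ≤ Λ ∧ α + 1 < s ∧ ∀ m w, MemK N T α γ' m₀ m w → ∀ l, Λ ≤ l →
      (volume.restrict (QQ N T)).real {q | l < m q.1 q.2}
        ≤ C * l ^ (-s) * ((∫ q in QQ N T, kinQ γ' (m q.1 q.2) (w q.1 q.2))
          + ∫ q in QQ N T, m q.1 q.2 ^ (α + 1)) := by
  have hN0 : (0 : ℝ) < N := by exact_mod_cast hN
  have hN1 : N ≠ 0 := by omega
  have hg1 : 0 < γ - 1 := by linarith
  set q := γ * (α + 1) / α with hq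
  have hq1 : 0 < q - 1 := by
    rw [hq, sub_pos, lt_div_iff₀ hα]
    nlinarith
  set c := gkMass N with hc
  have hc0 : 0 < c := gkMass_pos N
  set b := (4 * gkConst N / c) ^ ((N : ℝ)⁻¹) with hb
  have hb0 : 0 < b := Real.rpow_pos_of_pos (div_pos (mul_pos four_pos (gkConst_pos N)) hc0) _
  have hbN : b ^ N = 4 * gkConst N / c :=
    Real.rpow_inv_natCast_pow (div_pos (mul_pos four_pos (gkConst_pos N)) hc0).le hN1
  obtain ⟨B, hB, hB0⟩ : ∃ B : ℝ, N * (gkMoment N * b) ^ q * B ^ (1 - q) ≤ c / 4 ∧ 0 < B := by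
    have h := (tendsto_rpow_neg_atTop hq1).const_mul (N * (gkMoment N * b) ^ q)
    rw [mul_zero, neg_sub] at h
    exact ((h.eventually_le_const (by positivity : 0 < c / 4)).and (eventually_gt_atTop 0)).exists
  set σ := (1 + q / N) / (q - 1) with hσ
  refine ⟨4 * N * B / c, max (max 1 (b ^ N)) (4 * M₀), σ + 1, by positivity,
    (le_max_left _ _).trans (le_max_left _ _), ?_, fun m w hK l hl => ?_⟩
  · have h1 : α * N * (γ - 1) < γ := by
      rwa [hγ', lt_div_iff₀ hN0, lt_div_iff₀ hg1] at hsub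
    have hqa : q * α = γ * (α + 1) := by rw [hq]; field_simp
    rw [add_lt_add_iff_right, hσ, lt_div_iff₀ hq1, ← mul_lt_mul_iff_left₀ hN0]
    have : (1 + q / N) * N = N + q := by field_simp
    rw [this, ← mul_lt_mul_iff_left₀ hα]
    have e : α * (q - 1) * N * α = α * N * (q * α - α) := by ring
    rw [e, add_mul, hqa]
    nlinarith
  · have hl1 : 1 ≤ l := ((le_max_left _ _).trans (le_max_left _ _)).trans hl
    have hlb : b ^ N ≤ l := ((le_max_right _ _).trans (le_max_left _ _)).trans hl
    have hlM : 4 * M₀ ≤ l := (le_max_right _ _).trans hl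
    have hl0 : 0 < l := by linarith
    set δ := b * l ^ (-(N : ℝ)⁻¹) with hδ
    have hlN : (l ^ (-(N : ℝ)⁻¹)) ^ N = l⁻¹ := by
      rw [← Real.rpow_natCast, ← Real.rpow_mul hl0.le, neg_mul, inv_mul_cancel₀ hN0.ne',
        Real.rpow_neg_one]
    have hδN : δ ^ N = b ^ N * l⁻¹ := by rw [hδ, mul_pow, hlN]
    have hδ0 : 0 < δ := by positivity
    have hδ1 : δ ≤ 1 := by
      refine (pow_le_one_iff_of_nonneg hδ0.le hN1).1 ?_
      rw [hδN, ← div_eq_mul_inv]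
      exact (div_le_one hl0).2 hlb
    set τ := B * l ^ (-σ) with hτ
    have hτ0 : 0 < τ := by positivity
    have h := hK.level_set_le hT hγ hγ' hα hm₀ hm₀c hM₀ hM₀0 hδ0 hδ1 hτ0 l
    have t1 : gkConst N * (δ ^ N)⁻¹ = c / 4 * l := by
      have := gkConst_pos N
      rw [hδN, hbN]
      field_simp
    have t3 : N * τ ^ (1 - q) * (gkMoment N * δ) ^ q ≤ c / 4 * l := by
      have hG := gkMoment_nonneg N
      have e1 : τ ^ (1 - q) = B ^ (1 - q) * l ^ (-σ * (1 - q)) := by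
        rw [hτ, Real.mul_rpow hB0.le (by positivity), ← Real.rpow_mul hl0.le]
      have e2 : (gkMoment N * δ) ^ q = (gkMoment N * b) ^ q * l ^ (-(N : ℝ)⁻¹ * q) := by
        rw [hδ, ← mul_assoc, Real.mul_rpow (by positivity) (by positivity),
          ← Real.rpow_mul hl0.le]
      have e3 : l ^ (-σ * (1 - q)) * l ^ (-(N : ℝ)⁻¹ * q) = l := by
        rw [← Real.rpow_add hl0]
        have : -σ * (1 - q) + -(N : ℝ)⁻¹ * q = 1 := by
          rw [hσ]; field_simp; ring
        rw [this, Real.rpow_one]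
      calc N * τ ^ (1 - q) * (gkMoment N * δ) ^ q
          = N * (gkMoment N * b) ^ q * B ^ (1 - q)
            * (l ^ (-σ * (1 - q)) * l ^ (-(N : ℝ)⁻¹ * q)) := by rw [e1, e2]; ring
        _ ≤ c / 4 * l := by
          rw [e3]
          exact mul_le_mul_of_nonneg_right hB hl0.le
    have t2 : M₀ * c ≤ c / 4 * l := by nlinarith
    have hd : 0 ≤ (volume.restrict (QQ N T)).real {q | l < m q.1 q.2} := measureReal_nonneg
    set d := (volume.restrict (QQ N T)).real {q | l < m q.1 q.2}
    set E := (∫ q in QQ N T, kinQ γ' (m q.1 q.2) (w q.1 q.2))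
      + ∫ q in QQ N T, m q.1 q.2 ^ (α + 1)
    have h2 : c / 4 * l * d ≤ N * τ * E := by
      refine le_trans (mul_le_mul_of_nonneg_right ?_ hd) h
      linarith
    have e4 : l ^ (-(σ + 1)) = l ^ (-σ) * l⁻¹ := by
      rw [neg_add, Real.rpow_add hl0, Real.rpow_neg_one]
    have e5 : 4 * N * B / c * l ^ (-(σ + 1)) * E = N * τ * E / (c / 4 * l) := by
      rw [e4, hτ]; field_simp
    rw [e5, le_div_iff₀ (by positivity)]
    linarith

/-- In the subcritical regime the `L^{α+1}` norm is absorbed by the kinetic energy. -/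
lemma exists_integral_rpow_le (hN : 1 ≤ N) (hT : 0 < T) (hγ : 1 < γ) (hγ' : γ' = γ / (γ - 1))
    (hα : 0 < α) (hsub : α < γ' / N) (hm₀ : (∫ x in cube N, m₀ x) = 1) (hm₀c : Continuous m₀)
    {M₀ : ℝ} (hM₀ : ∀ x, m₀ x ≤ M₀) (hM₀0 : 0 ≤ M₀) {ε : ℝ} (hε : 0 < ε) :
    ∃ C : ℝ, 0 ≤ C ∧ ∀ m w, MemK N T α γ' m₀ m w →
      ∫ q in QQ N T, m q.1 q.2 ^ (α + 1)
        ≤ ε * (∫ q in QQ N T, kinQ γ' (m q.1 q.2) (w q.1 q.2)) + C := by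
  obtain ⟨C, Λ₀, s, hC, hΛ₀, hs, hdec⟩ :=
    exists_level_set_decay hN hT hγ hγ' hα hsub hm₀ hm₀c hM₀ hM₀0
  have hsp : 0 < s - (α + 1) := by linarith
  obtain ⟨Λ, hΛ, hΛΛ⟩ : ∃ Λ : ℝ, (α + 1) * C / (s - (α + 1)) * Λ ^ (-(s - (α + 1)))
      ≤ ε / (1 + ε) ∧ Λ₀ ≤ Λ := by
    have h := (tendsto_rpow_neg_atTop hsp).const_mul ((α + 1) * C / (s - (α + 1)))
    rw [mul_zero] at h
    exact ((h.eventually_le_const (by positivity : 0 < ε / (1 + ε))).and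
      (eventually_ge_atTop Λ₀)).exists
  have hΛ0 : 0 < Λ := by linarith
  refine ⟨(1 + ε) * (T * Λ ^ (α + 1)), by positivity, fun m w hK => ?_⟩
  set k := ∫ q in QQ N T, kinQ γ' (m q.1 q.2) (w q.1 q.2) with hk
  set X := ∫ q in QQ N T, m q.1 q.2 ^ (α + 1) with hX
  have hk0 : 0 ≤ k := integral_nonneg fun q => kinQ_nonneg _
  have hX0 : 0 ≤ X := integral_nonneg fun q => Real.rpow_nonneg (hK.nonneg _ _) _
  have hmain : X ≤ T * Λ ^ (α + 1)
      + (α + 1) * C / (s - (α + 1)) * Λ ^ (-(s - (α + 1))) * (k + X) := by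
    set μ := volume.restrict (QQ N T) with hμ
    have hcake : ENNReal.ofReal X = ENNReal.ofReal (α + 1)
        * ∫⁻ t in Ioi 0, μ {q | t < m q.1 q.2} * ENNReal.ofReal (t ^ (α + 1 - 1)) := by
      rw [hX, ofReal_integral_eq_lintegral_ofReal hK.lp_m
        (ae_of_all _ fun q => Real.rpow_nonneg (hK.nonneg _ _) _)]
      exact lintegral_rpow_eq_lintegral_meas_lt_mul μ (ae_of_all _ fun q => hK.nonneg _ _)
        (hK.aestronglyMeasurable hα).aemeasurable (by linarith)
    have i1 : ∫⁻ t in Ioc 0 Λ, μ {q | t < m q.1 q.2} * ENNReal.ofReal (t ^ (α + 1 - 1))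
        ≤ ENNReal.ofReal (T * (Λ ^ (α + 1) / (α + 1))) := by
      have e : T * (Λ ^ (α + 1) / (α + 1)) = ∫ t in Ioc 0 Λ, T * t ^ α := by
        rw [integral_const_mul, ← intervalIntegral.integral_of_le hΛ0.le,
          integral_rpow (Or.inl (by linarith)), Real.zero_rpow (by linarith), sub_zero]
      have hi : IntegrableOn (fun t : ℝ => T * t ^ α) (Ioc 0 Λ) :=
        ((intervalIntegral.intervalIntegrable_rpow' (by linarith)).1).const_mul T
      rw [e, ofReal_integral_eq_lintegral_ofReal hi]
      · refine setLIntegral_mono' measurableSet_Ioc fun t ht => ?_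
        rw [ENNReal.ofReal_mul hT.le, add_sub_cancel_right]
        gcongr
        refine (measure_mono (subset_univ _)).trans_eq ?_
        rw [hμ, Measure.restrict_apply_univ, volume_QQ]
      · filter_upwards [ae_restrict_mem measurableSet_Ioc] with t ht
        exact mul_nonneg hT.le (Real.rpow_nonneg ht.1.le _)
    have i2 : ∫⁻ t in Ioi Λ, μ {q | t < m q.1 q.2} * ENNReal.ofReal (t ^ (α + 1 - 1))
        ≤ ENNReal.ofReal (C * (k + X) * (Λ ^ (-(s - (α + 1))) / (s - (α + 1)))) := by
      have e : C * (k + X) * (Λ ^ (-(s - (α + 1))) / (s - (α + 1)))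
          = ∫ t in Ioi Λ, C * (k + X) * t ^ (α - s) := by
        rw [integral_const_mul, integral_Ioi_rpow_of_lt (by linarith) hΛ0,
          show α - s + 1 = -(s - (α + 1)) by ring, neg_div_neg_eq]
      have hi : IntegrableOn (fun t : ℝ => C * (k + X) * t ^ (α - s)) (Ioi Λ) :=
        (integrableOn_Ioi_rpow_of_lt (by linarith) hΛ0).const_mul _
      rw [e, ofReal_integral_eq_lintegral_ofReal hi]
      · refine setLIntegral_mono' measurableSet_Ioi fun t ht => ?_
        have ht0 : 0 < t := hΛ0.trans ht
        have h := hdec m w hK t (hΛΛ.trans (le_of_lt ht))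
        rw [← ofReal_measureReal, add_sub_cancel_right, ← ENNReal.ofReal_mul measureReal_nonneg]
        refine ENNReal.ofReal_le_ofReal ?_
        calc μ.real {q | t < m q.1 q.2} * t ^ α ≤ C * t ^ (-s) * (k + X) * t ^ α :=
              mul_le_mul_of_nonneg_right h (Real.rpow_nonneg ht0.le _)
          _ = C * (k + X) * t ^ (α - s) := by
              rw [sub_eq_add_neg, Real.rpow_add ht0]; ring
      · filter_upwards [ae_restrict_mem measurableSet_Ioi] with t ht
        have : 0 < t := hΛ0.trans ht
        positivity
    have hsplit : ENNReal.ofReal X ≤ ENNReal.ofReal ((α + 1) * (T * (Λ ^ (α + 1) / (α + 1))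
        + C * (k + X) * (Λ ^ (-(s - (α + 1))) / (s - (α + 1))))) := by
      rw [hcake, ENNReal.ofReal_mul (by linarith), ← Ioc_union_Ioi_eq_Ioi hΛ0.le,
        lintegral_union measurableSet_Ioi (Ioc_disjoint_Ioi le_rfl)]
      gcongr
      rw [ENNReal.ofReal_add (by positivity) (by positivity)]
      exact add_le_add i1 i2
    rw [ENNReal.ofReal_le_ofReal_iff (by positivity)] at hsplit
    refine hsplit.trans_eq ?_
    field_simp
  have h2 : X ≤ T * Λ ^ (α + 1) + ε / (1 + ε) * (k + X) :=
    hmain.trans (by gcongr)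
  have h3 : (1 + ε) * X ≤ (1 + ε) * (T * Λ ^ (α + 1)) + ε * (k + X) := by
    have := mul_le_mul_of_nonneg_left h2 (by linarith : 0 ≤ 1 + ε)
    have e : (1 + ε) * (ε / (1 + ε) * (k + X)) = ε * (k + X) := by field_simp
    linarith
  linarith

end LevelSets

section Energy

variable {N : ℕ}

lemma dotp_le (p q : RN N) : dotp p q ≤ euclNorm p * euclNorm q := by
  rw [dotp, euclNorm, euclNorm]
  exact Real.sum_mul_le_sqrt_mul_sqrt _ _ _

lemma euclNorm_smul (c : ℝ) (p : RN N) : euclNorm (c • p) = |c| * euclNorm p := by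
  simp only [euclNorm, Pi.smul_apply, smul_eq_mul, mul_pow]
  rw [← Finset.mul_sum, Real.sqrt_mul (sq_nonneg c), Real.sqrt_sq_eq_abs]

lemma bddAbove_dotp_sub {H : RN N → ℝ} {γ C : ℝ} (hγ : 1 < γ) (hC : 0 < C)
    (hH : ∀ p, C⁻¹ * euclNorm p ^ γ ≤ H p) (q : RN N) :
    BddAbove (range fun p => dotp p q - H p) := by
  have hq := euclNorm_nonneg q
  set R := (C * euclNorm q) ^ (γ - 1)⁻¹ with hR
  have hg : 0 < γ - 1 := by linarith
  have hR0 : 0 ≤ R := by positivity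
  refine ⟨R * euclNorm q, ?_⟩
  rintro _ ⟨p, rfl⟩
  have hp := euclNorm_nonneg p
  have h1 := dotp_le p q
  have h2 := hH p
  change dotp p q - H p ≤ R * euclNorm q
  rcases le_total (euclNorm p) R with h | h
  · have h3 := mul_le_mul_of_nonneg_right h hq
    have h4 : 0 ≤ C⁻¹ * euclNorm p ^ γ := by positivity
    linarith
  · have h3 : C * euclNorm q ≤ euclNorm p ^ (γ - 1) := by
      have := Real.rpow_le_rpow hR0 h hg.le
      rwa [hR, Real.rpow_inv_rpow (by positivity) hg.ne'] at this
    have h4 : euclNorm p ^ γ = euclNorm p ^ (γ - 1) * euclNorm p := by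
      rw [← Real.rpow_add_one' hp (by linarith)]
      ring_nf
    have h5 : C⁻¹ * (C * euclNorm q * euclNorm p) ≤ C⁻¹ * euclNorm p ^ γ := by
      rw [h4]
      gcongr
    have h6 : C⁻¹ * (C * euclNorm q * euclNorm p) = euclNorm p * euclNorm q := by
      field_simp
    have h7 : 0 ≤ R * euclNorm q := by positivity
    linarith

lemma measurable_Leg {H : RN N → ℝ} {γ C : ℝ} (hγ : 1 < γ) (hC : 0 < C)
    (hH : ∀ p, C⁻¹ * euclNorm p ^ γ ≤ H p) : Measurable (Leg H) := by
  have h : LowerSemicontinuous fun q => ⨆ p, (dotp p q - H p) := by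
    refine lowerSemicontinuous_ciSup (bddAbove_dotp_sub hγ hC hH) fun p => ?_
    refine Continuous.lowerSemicontinuous ?_
    unfold dotp
    fun_prop
  have e : Leg H = fun q => ⨆ p, (dotp p q - H p) := by
    funext q
    rw [Leg, image_univ]
    rfl
  rw [e]
  exact h.measurable

lemma measurable_mLag {L : RN N → ℝ} (hL : Measurable L) :
    Measurable fun z : ℝ × RN N => mLag L z.1 z.2 := by
  unfold mLag
  refine Measurable.ite (measurableSet_lt measurable_const measurable_fst) ?_ measurable_const
  exact measurable_fst.mul (hL.comp (measurable_fst.inv.neg.smul measurable_snd))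

lemma mul_euclNorm_smul_rpow {γ' a : ℝ} (ha : 0 < a) (b : RN N) :
    a * euclNorm ((-a⁻¹) • b) ^ γ' = kinQ γ' a b := by
  rw [kinQ, if_pos ha, euclNorm_smul, abs_neg, abs_of_pos (inv_pos.2 ha),
    Real.mul_rpow (inv_pos.2 ha).le (euclNorm_nonneg _), Real.inv_rpow ha.le,
    ← Real.rpow_neg ha.le, sub_eq_add_neg, Real.rpow_add ha, Real.rpow_one]
  ring

lemma mLag_bounds {L : RN N → ℝ} {γ' C : ℝ} (hL : ∀ q, C⁻¹ * euclNorm q ^ γ' - C ≤ L q ∧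
      L q ≤ C * (euclNorm q ^ γ' + 1)) {a : ℝ} (ha : 0 ≤ a) (b : RN N) :
    C⁻¹ * kinQ γ' a b - C * a ≤ mLag L a b ∧ mLag L a b ≤ C * (kinQ γ' a b + a) := by
  rcases ha.eq_or_lt with h | h
  · simp [mLag, kinQ, ← h]
  · have h1 := mul_le_mul_of_nonneg_left (hL ((-a⁻¹) • b)).1 ha
    have h2 := mul_le_mul_of_nonneg_left (hL ((-a⁻¹) • b)).2 ha
    rw [mLag, if_pos h, ← mul_euclNorm_smul_rpow h b]
    constructor <;> linarith

section Coupling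

variable {f f' : RN N → ℝ → ℝ} {α c_f : ℝ}

lemma exists_le_mul_add_one_rpow (hα : 0 < α) (hcf : 0 < c_f)
    (hfcont : ContinuousOn (fun q : RN N × ℝ => f q.1 q.2) (univ ×ˢ Ici (0:ℝ)))
    (hfper : ZPeriodic fun x => f x 0)
    (hfder : ∀ x s, 0 ≤ s → HasDerivAt (f x) (f' x s) s)
    (hfb : ∀ x s, 0 ≤ s → |f' x s| ≤ c_f * (s + 1) ^ (α - 1)) :
    ∃ C, 0 ≤ C ∧ ∀ x s, 0 ≤ s → f x s ≤ C * (s + 1) ^ α := by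
  have hc0 : Continuous fun x => f x 0 := by
    rw [← continuousOn_univ]
    exact hfcont.comp (f := fun x : RN N => (x, (0 : ℝ))) (by fun_prop)
      fun x _ => ⟨mem_univ _, self_mem_Ici⟩
  obtain ⟨C₀, hC₀, hb⟩ := hfper.exists_bound hc0
  refine ⟨C₀ + c_f / α, by positivity, fun x s hs => ?_⟩
  have hd : ∀ t, 0 ≤ t → HasDerivAt (fun t => c_f / α * (t + 1) ^ α - f x t)
      (c_f * (t + 1) ^ (α - 1) - f' x t) t := fun t ht => by
    have h1 : HasDerivAt (fun t : ℝ => (t + 1) ^ α) (1 * α * (t + 1) ^ (α - 1)) t :=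
      ((hasDerivAt_id t).add_const 1).rpow_const (Or.inl (by simp only [id]; linarith))
    have e : c_f / α * (1 * α * (t + 1) ^ (α - 1)) = c_f * (t + 1) ^ (α - 1) := by
      field_simp
    rw [← e]
    exact (h1.const_mul (c_f / α)).sub (hfder x t ht)
  have hmono : MonotoneOn (fun t => c_f / α * (t + 1) ^ α - f x t) (Ici 0) := by
    refine monotoneOn_of_deriv_nonneg (convex_Ici 0)
      (fun t ht => (hd t ht).continuousAt.continuousWithinAt) (fun t ht => ?_) fun t ht => ?_
    · exact (hd t (interior_subset ht)).differentiableAt.differentiableWithinAt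
    · rw [(hd t (interior_subset ht)).deriv]
      linarith [le_of_abs_le (hfb x t (interior_subset ht))]
  have h := hmono self_mem_Ici hs hs
  simp only [zero_add, Real.one_rpow] at h
  have h0 := le_of_abs_le (hb x)
  have h1 : 1 ≤ (s + 1) ^ α := Real.one_le_rpow (by linarith) hα.le
  have h2 : 0 < c_f / α := by positivity
  nlinarith

lemma add_one_rpow_le {s p : ℝ} (hs : 0 ≤ s) (hp : 0 ≤ p) :
    (s + 1) ^ p ≤ 2 ^ p * (s ^ p + 1) := by
  have h0 := Real.rpow_nonneg hs p
  have h2 : (0 : ℝ) ≤ 2 ^ p := by positivity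
  rcases le_total s 1 with h | h
  · calc (s + 1) ^ p ≤ 2 ^ p := Real.rpow_le_rpow (by linarith) (by linarith) hp
      _ ≤ 2 ^ p * (s ^ p + 1) := le_mul_of_one_le_right h2 (by linarith)
  · calc (s + 1) ^ p ≤ (2 * s) ^ p := Real.rpow_le_rpow (by linarith) (by linarith) hp
      _ = 2 ^ p * s ^ p := Real.mul_rpow (by norm_num) hs
      _ ≤ 2 ^ p * (s ^ p + 1) := by gcongr; linarith

lemma abs_Fint_le {C : ℝ} (hα : 0 < α) (hC : 0 ≤ C) (hfnn : ∀ x s, 0 ≤ s → 0 ≤ f x s)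
    (hf : ∀ x s, 0 ≤ s → f x s ≤ C * (s + 1) ^ α) (x : RN N) {s : ℝ} (hs : 0 ≤ s) :
    |Fint f x s| ≤ C * 2 ^ (α + 1) * (s ^ (α + 1) + 1) := by
  have h1 : |Fint f x s| ≤ C * (s + 1) ^ α * |s - 0| := by
    refine intervalIntegral.norm_integral_le_of_norm_le_const (f := f x) fun t ht => ?_
    rw [uIoc_of_le hs] at ht
    rw [Real.norm_of_nonneg (hfnn x t ht.1.le)]
    refine (hf x t ht.1.le).trans ?_
    have := ht.1
    have := ht.2
    gcongr
  rw [sub_zero, abs_of_nonneg hs] at h1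
  have h2 := mul_le_mul_of_nonneg_left (add_one_rpow_le hs (by linarith : 0 ≤ α + 1)) hC
  have h3 : (s + 1) ^ (α + 1) = (s + 1) ^ α * (s + 1) := Real.rpow_add_one (by linarith) _
  have h4 : C * (s + 1) ^ α * s ≤ C * (s + 1) ^ (α + 1) := by
    rw [h3, mul_assoc]
    gcongr
    linarith
  linarith

lemma continuous_Fint_max
    (hfcont : ContinuousOn (fun q : RN N × ℝ => f q.1 q.2) (univ ×ˢ Ici (0:ℝ))) :
    Continuous fun q : RN N × ℝ => Fint (fun x s => f x (max s 0)) q.1 q.2 := by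
  refine intervalIntegral.continuous_parametric_intervalIntegral_of_continuous
    (f := fun (q : RN N × ℝ) s => f q.1 (max s 0)) ?_ continuous_snd
  exact hfcont.comp_continuous (f := fun z : (RN N × ℝ) × ℝ => (z.1.1, max z.2 0)) (by fun_prop)
    fun z => ⟨mem_univ _, le_max_right z.2 0⟩

lemma Fint_max_eq (x : RN N) {s : ℝ} (hs : 0 ≤ s) :
    Fint (fun x s => f x (max s 0)) x s = Fint f x s := by
  refine intervalIntegral.integral_congr fun t ht => ?_
  rw [uIcc_of_le hs] at ht
  simp only [max_eq_left ht.1]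

end Coupling

/-- The energy controls the kinetic energy up to the `L^{α+1}` norm. -/
lemma MemK.le_energyF {T α γ' C_L C_F U : ℝ} {m₀ uT : RN N → ℝ} {m : RN N → ℝ → ℝ}
    {w : RN N → ℝ → RN N} {L : RN N → ℝ} {F : RN N → ℝ → ℝ} (hT : 0 < T) (hα : 0 < α)
    (hm₀ : (∫ x in cube N, m₀ x) = 1) (hK : MemK N T α γ' m₀ m w) (hLm : Measurable L)
    (hL : ∀ q, C_L⁻¹ * euclNorm q ^ γ' - C_L ≤ L q ∧ L q ≤ C_L * (euclNorm q ^ γ' + 1))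
    (hCL : 0 < C_L)
    (hFm : AEStronglyMeasurable (fun q : RN N × ℝ => F q.1 (m q.1 q.2))
      (volume.restrict (QQ N T)))
    (hF : ∀ x s, 0 ≤ s → |F x s| ≤ C_F * (s ^ (α + 1) + 1))
    (huT : Continuous uT) (hU : ∀ x, |uT x| ≤ U) :
    C_L⁻¹ * (∫ q in QQ N T, kinQ γ' (m q.1 q.2) (w q.1 q.2))
      - C_F * (∫ q in QQ N T, m q.1 q.2 ^ (α + 1)) - (C_L * T + C_F * T + U)
      ≤ energyF N T L F uT m w := by
  have hm := hK.integrableOn hα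
  have hLi : IntegrableOn (fun q : RN N × ℝ => mLag L (m q.1 q.2) (w q.1 q.2)) (QQ N T) := by
    refine ((hK.kin_int.add hm).const_mul C_L).mono' ?_ (ae_of_all _ fun q => ?_)
    · exact ((measurable_mLag hLm).comp_aemeasurable
        ((hK.aestronglyMeasurable hα).aemeasurable.prodMk
          hK.l1_w.aestronglyMeasurable.aemeasurable)).aestronglyMeasurable
    · have h := mLag_bounds hL (hK.nonneg q.1 q.2) (w q.1 q.2)
      have hk := kinQ_nonneg (γ' := γ') (a := m q.1 q.2) (w q.1 q.2)
      have hm0 := hK.nonneg q.1 q.2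
      have h1 : 0 ≤ C_L⁻¹ * kinQ γ' (m q.1 q.2) (w q.1 q.2) := by positivity
      have h2 : 0 ≤ C_L * kinQ γ' (m q.1 q.2) (w q.1 q.2) := by positivity
      refine abs_le.2 ⟨?_, h.2⟩
      simp only [Pi.add_apply]
      linarith [h.1]
  have hpi : IntegrableOn (fun q : RN N × ℝ => m q.1 q.2 ^ (α + 1) + 1) (QQ N T) :=
    hK.lp_m.add (integrable_const 1)
  have hFi : IntegrableOn (fun q : RN N × ℝ => F q.1 (m q.1 q.2)) (QQ N T) :=
    (hpi.const_mul C_F).mono' hFm (ae_of_all _ fun q => hF _ _ (hK.nonneg _ _))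
  have h1 : ∫ q in QQ N T, (C_L⁻¹ * kinQ γ' (m q.1 q.2) (w q.1 q.2) - C_L * m q.1 q.2)
      ≤ ∫ q in QQ N T, mLag L (m q.1 q.2) (w q.1 q.2) :=
    integral_mono ((hK.kin_int.const_mul _).sub (hm.const_mul _)) hLi
      fun q => (mLag_bounds hL (hK.nonneg _ _) _).1
  rw [integral_sub (hK.kin_int.const_mul _) (hm.const_mul _), integral_const_mul,
    integral_const_mul, hK.integral_eq hT hm₀] at h1
  have h2 : ∫ q in QQ N T, F q.1 (m q.1 q.2)
      ≤ ∫ q in QQ N T, C_F * (m q.1 q.2 ^ (α + 1) + 1) :=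
    integral_mono hFi (hpi.const_mul C_F) fun q => le_of_abs_le (hF _ _ (hK.nonneg _ _))
  rw [integral_const_mul, integral_add hK.lp_m (integrable_const 1), setIntegral_const,
    smul_eq_mul, mul_one, Measure.real, volume_QQ, ENNReal.toReal_ofReal hT.le] at h2
  have h3 : ∫ x in cube N, -U * m x T ≤ ∫ x in cube N, uT x * m x T := by
    refine integral_mono (hK.traceInt.const_mul _) ?_ fun x => ?_
    · exact hK.traceInt.bdd_mul (c := U) huT.aestronglyMeasurable (ae_of_all _ hU)
    · exact mul_le_mul_of_nonneg_right (neg_le_of_abs_le (hU x)) (hK.nonneg _ _)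
  rw [integral_const_mul, hK.integral_final_eq hm₀] at h3
  rw [energyF, intQ, integral_sub hLi hFi]
  linarith

end Energy

/-- **Lemma 3.2**: in the subcritical regime `α < γ'/N` the energy is bounded from
below on `K` (its infimum is finite), and sublevel sets of the energy are bounded in
`L^{α+1} × L^{γ'}(m)`. -/
theorem energy_bounded_below (N : ℕ) (hN : 1 ≤ N) (T : ℝ) (hT : 0 < T)
    (γ γ' C_H C_L c_f α : ℝ)
    (H : RN N → ℝ) (f f' : RN N → ℝ → ℝ) (m₀ uT : RN N → ℝ)
    (hγ : 1 < γ) (hγ' : γ' = γ / (γ - 1))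
    (hCH : 0 < C_H) (hHconv : ConvexOn ℝ Set.univ H) (hHreg : ContDiff ℝ 3 H)
    (hHgrowth : ∀ p, C_H⁻¹ * euclNorm p ^ γ ≤ H p ∧ H p ≤ C_H * (euclNorm p ^ γ + 1))
    (hCL : 0 < C_L)
    (hLgrowth : ∀ q, C_L⁻¹ * euclNorm q ^ γ' - C_L ≤ Leg H q ∧
      Leg H q ≤ C_L * (euclNorm q ^ γ' + 1))
    (hα : 0 < α) (hcf : 0 < c_f)
    (hfcont : ContinuousOn (fun q : RN N × ℝ => f q.1 q.2)
      ((Set.univ : Set (RN N)) ×ˢ Ici (0:ℝ)))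
    (hfper : ∀ s, ZPeriodic fun x => f x s)
    (hfnn : ∀ x s, 0 ≤ s → 0 ≤ f x s)
    (hfder : ∀ x s, 0 ≤ s → HasDerivAt (f x) (f' x s) s)
    (hfb : ∀ x s, 0 ≤ s → |f' x s| ≤ c_f * (s + 1) ^ (α - 1))
    (hm₀reg : ContDiff ℝ 2 m₀) (hm₀per : ZPeriodic m₀) (hm₀pos : ∀ x, 0 < m₀ x)
    (hm₀int : (∫ x in cube N, m₀ x) = 1)
    (huTreg : ContDiff ℝ 2 uT) (huTper : ZPeriodic uT)
    (hsub : α < γ' / N) :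
    (∃ cinf : ℝ, IsGLB {e : ℝ | ∃ m w, MemK N T α γ' m₀ m w ∧
        e = energyF N T (Leg H) (Fint f) uT m w} cinf) ∧
    ∀ e : ℝ, ∃ c₁ > (0:ℝ), ∀ m w, MemK N T α γ' m₀ m w →
      energyF N T (Leg H) (Fint f) uT m w ≤ e →
      intQ N T (fun x t => m x t ^ (α + 1)) +
        intQ N T (fun x t => kinQ γ' (m x t) (w x t)) ≤ c₁ := by
  have hγ'0 : 0 ≤ γ' := by
    rw [hγ']
    exact div_nonneg (by linarith) (by linarith)
  obtain ⟨M₀, hM₀0, hM₀⟩ := hm₀per.exists_bound hm₀reg.continuous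
  obtain ⟨U, -, hU⟩ := huTper.exists_bound huTreg.continuous
  obtain ⟨A, hA0, hA⟩ := exists_le_mul_add_one_rpow hα hcf hfcont (hfper 0) hfder hfb
  have hF := fun x s (hs : 0 ≤ s) => abs_Fint_le hα hA0 hfnn hA x hs
  set C_F := A * 2 ^ (α + 1)
  have hCF : 0 ≤ C_F := by positivity
  have hX := fun (ε : ℝ) (hε : 0 < ε) => exists_integral_rpow_le hN hT hγ hγ' hα hsub hm₀int
    hm₀reg.continuous (fun x => le_of_abs_le (hM₀ x)) hM₀0 hε
  obtain ⟨C, -, hC⟩ := hX (C_L⁻¹ / (2 * (C_F + 1))) (by positivity)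
  have hE : ∀ m w, MemK N T α γ' m₀ m w →
      C_L⁻¹ / 2 * (∫ q in QQ N T, kinQ γ' (m q.1 q.2) (w q.1 q.2))
        - (C_F * C + (C_L * T + C_F * T + U)) ≤ energyF N T (Leg H) (Fint f) uT m w := by
    intro m w hK
    have hFm : AEStronglyMeasurable (fun q : RN N × ℝ => Fint f q.1 (m q.1 q.2))
        (volume.restrict (QQ N T)) := by
      refine ((continuous_Fint_max hfcont).comp_aestronglyMeasurable
        (measurable_fst.aestronglyMeasurable.prodMk (hK.aestronglyMeasurable hα))).congr
        (ae_of_all _ fun q => ?_)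
      exact Fint_max_eq q.1 (hK.nonneg q.1 q.2)
    refine le_trans ?_ (hK.le_energyF hT hα hm₀int
      (measurable_Leg hγ hCH fun p => (hHgrowth p).1) hLgrowth hCL hFm hF huTreg.continuous hU)
    have hk : 0 ≤ ∫ q in QQ N T, kinQ γ' (m q.1 q.2) (w q.1 q.2) :=
      integral_nonneg fun q => kinQ_nonneg _
    have h1 := mul_le_mul_of_nonneg_left (hC m w hK) hCF
    have h2 : C_F * (C_L⁻¹ / (2 * (C_F + 1))) ≤ C_L⁻¹ / 2 := by
      rw [mul_div_assoc', div_le_div_iff₀ (by positivity) (by positivity)]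
      have : 0 < C_L⁻¹ := by positivity
      nlinarith
    have h3 := mul_le_mul_of_nonneg_right h2 hk
    linarith
  refine ⟨⟨_, isGLB_csInf ⟨_, _, _, memK_stationary hT hγ'0 hm₀reg hm₀per hm₀pos, rfl⟩
    ⟨-(C_F * C + (C_L * T + C_F * T + U)), ?_⟩⟩, fun e => ?_⟩
  · rintro _ ⟨m, w, hK, rfl⟩
    have hk : 0 ≤ C_L⁻¹ / 2 * ∫ q in QQ N T, kinQ γ' (m q.1 q.2) (w q.1 q.2) :=
      mul_nonneg (by positivity) (integral_nonneg fun q => kinQ_nonneg _)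
    linarith [hE m w hK]
  · obtain ⟨C₁, -, hC₁⟩ := hX 1 one_pos
    refine ⟨max 1 (2 * (2 * C_L * (e + (C_F * C + (C_L * T + C_F * T + U)))) + C₁),
      lt_max_of_lt_left one_pos, fun m w hK he => le_max_of_le_right ?_⟩
    have h1 := hC₁ m w hK
    have h2 := (hE m w hK).trans he
    have h3 : ∫ q in QQ N T, kinQ γ' (m q.1 q.2) (w q.1 q.2)
        ≤ 2 * C_L * (e + (C_F * C + (C_L * T + C_F * T + U))) := by
      have h4 := mul_le_mul_of_nonneg_left (sub_le_iff_le_add.1 h2)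
        (by positivity : 0 ≤ 2 * C_L)
      have h5 : ∀ k : ℝ, 2 * C_L * (C_L⁻¹ / 2 * k) = k := fun k => by field_simp
      rwa [h5] at h4
    simp only [intQ]
    linarith
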